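/- Let F be a field of characteristic ≠ 2 and let (A,σ) = (Q₁,σ₁) ⊗ (Q₂,σ₂) ⊗ (Q₃,σ₃), where each Qᵢ = ℍ[F,aᵢ,bᵢ] is a quaternion F-algebra, each σᵢ is an involution of the first kind on Qᵢ, and the involution σ = σ₁⊗σ₂⊗σ₃ on the degree-8 algebra A is orthogonal. If A is Brauer-equivalent to a central simple F-algebra of F-dimension ≤ 16 (index of A is ≤ 4), then there exist λ ∈ F×, quaternion F-algebras Q, Q′, and an orthogonal involution θ on the biquaternion algebra D = Q ⊗ Q′ such that (A,σ) ≅ (D,θ) ⊗ Ad_⟨⟨λ⟩⟩ as F-algebras with involution. -/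

import Mathlib

open scoped TensorProduct Quaternion Matrix

/-- An involution of the first kind on an `F`-algebra `A`: an `F`-linear anti-automorphism
of order two. -/
def IsInvolution (F A : Type) [CommSemiring F] [Ring A] [Algebra F A]
    (θ : A →ₗ[F] A) : Prop :=
  (∀ x y : A, θ (x * y) = θ y * θ x) ∧ (∀ x : A, θ (θ x) = x)

/-- The space of symmetric elements of a linear map. -/
def symmElements (F A : Type) [CommSemiring F] [AddCommGroup A] [Module F A]
    (θ : A →ₗ[F] A) : Submodule F A :=
  LinearMap.ker (θ - LinearMap.id)

/-- An involution of the first kind on a central simple algebra of degree `n` is orthogonal if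
its space of symmetric elements has dimension `n(n+1)/2`. -/
def IsOrthogonalInvolution (F A : Type) [Field F] [Ring A] [Algebra F A]
    (θ : A →ₗ[F] A) (n : ℕ) : Prop :=
  IsInvolution F A θ ∧ Module.finrank F (symmElements F A θ) = n * (n + 1) / 2

/-- Brauer equivalence over `F`: the two algebras are isomorphic to matrix algebras over a
common central division `F`-algebra. -/
def BrauerEquivalent (F : Type) [Field F] (A B : Type) [Ring A] [Algebra F A]
    [Ring B] [Algebra F B] : Prop :=
  ∃ (D : Type) (_ : DivisionRing D) (_ : Algebra F D) (n m : ℕ),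
    0 < n ∧ 0 < m ∧ Algebra.IsCentral F D ∧
    Nonempty (A ≃ₐ[F] Matrix (Fin n) (Fin n) D) ∧
    Nonempty (B ≃ₐ[F] Matrix (Fin m) (Fin m) D)

/-- The adjoint involution `X ↦ G⁻¹XᵀG` on `M₂(F)` with `G = diag(1, c)`. -/
noncomputable def adjInvo (F : Type) [Field F] (c : F) :
    Matrix (Fin 2) (Fin 2) F →ₗ[F] Matrix (Fin 2) (Fin 2) F where
  toFun X := (Matrix.diagonal ![1, c])⁻¹ * Xᵀ * Matrix.diagonal ![1, c]
  map_add' X Y := by simp [Matrix.transpose_add, Matrix.mul_add, Matrix.add_mul]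
  map_smul' r X := by simp [Matrix.transpose_smul, Matrix.mul_smul, Matrix.smul_mul]

set_option linter.all false

section Generic

/-- The space of skew elements of a linear map. -/
def skewElements (F A : Type) [CommSemiring F] [AddCommGroup A] [Module F A]
    (θ : A →ₗ[F] A) : Submodule F A :=
  LinearMap.ker (θ + LinearMap.id)

variable {F A : Type} [Field F] [Ring A] [Algebra F A]

lemma mem_symmElements {θ : A →ₗ[F] A} {x : A} : x ∈ symmElements F A θ ↔ θ x = x := by
  simp [symmElements, sub_eq_zero]

lemma mem_skewElements {θ : A →ₗ[F] A} {x : A} : x ∈ skewElements F A θ ↔ θ x = -x := by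
  simp [skewElements, add_eq_zero_iff_eq_neg]

lemma two_cancel (hF : (2:F) ≠ 0) {x : A} (h : x + x = 0) : x = 0 := by
  have : (2:F) • x = 0 := by rw [two_smul]; exact h
  exact (smul_eq_zero.mp this).resolve_left hF

lemma sym_skew_isCompl (hF : (2:F) ≠ 0) (θ : A →ₗ[F] A) (h : ∀ x, θ (θ x) = x) :
    IsCompl (symmElements F A θ) (skewElements F A θ) := by
  constructor
  · rw [Submodule.disjoint_def]
    intro x h1 h2
    rw [mem_symmElements] at h1
    rw [mem_skewElements, h1] at h2
    exact two_cancel hF (by nth_rewrite 1 [h2]; simp)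
  · rw [codisjoint_iff, Submodule.eq_top_iff']
    intro x
    rw [Submodule.mem_sup]
    refine ⟨(2:F)⁻¹ • (x + θ x), ?_, (2:F)⁻¹ • (x - θ x), ?_, ?_⟩
    · rw [mem_symmElements]; simp [h, add_comm]
    · rw [mem_skewElements]; simp [h, ← smul_neg]
    · rw [← smul_add]
      have : x + θ x + (x - θ x) = (2:F) • x := by rw [two_smul]; abel
      rw [this, smul_smul, inv_mul_cancel₀ hF, one_smul]

lemma finrank_sym_skew [FiniteDimensional F A] (hF : (2:F) ≠ 0) (θ : A →ₗ[F] A)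
    (h : ∀ x, θ (θ x) = x) :
    Module.finrank F (symmElements F A θ) + Module.finrank F (skewElements F A θ) =
      Module.finrank F A :=
  Submodule.finrank_add_eq_of_isCompl (sym_skew_isCompl hF θ h)

lemma IsInvolution.map_one' {θ : A →ₗ[F] A} (h : IsInvolution F A θ) : θ 1 = 1 := by
  have h1 := h.1 (θ 1) 1
  rw [mul_one, h.2, mul_one] at h1
  exact h1.symm

end Generic

section BiQ

/-- `D` contains two commuting quaternion pairs. -/
def BiQuat (F D : Type) [Field F] [Ring D] [Algebra F D] : Prop :=
  ∃ (a b a' b' : F) (i j i' j' : D), a ≠ 0 ∧ b ≠ 0 ∧ a' ≠ 0 ∧ b' ≠ 0 ∧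
    i * i = a • 1 ∧ j * j = b • 1 ∧ j * i = - (i * j) ∧
    i' * i' = a' • 1 ∧ j' * j' = b' • 1 ∧ j' * i' = - (i' * j') ∧
    i * i' = i' * i ∧ i * j' = j' * i ∧ j * i' = i' * j ∧ j * j' = j' * j

variable {F D : Type} [Field F] [Ring D] [Algebra F D]

lemma unit_of_sq {a : F} {i : D} (ha : a ≠ 0) (h : i * i = a • 1) {c : D} (hc : c * i = 0) :
    c = 0 := by
  have : c * i * i = 0 := by rw [hc, zero_mul]
  rw [mul_assoc, h, mul_smul_comm, mul_one] at this
  exact (smul_eq_zero.mp this).resolve_left ha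

lemma quat_indep_half (hF : (2:F) ≠ 0) {a b : F} {i j : D} (ha : a ≠ 0) (hb : b ≠ 0)
    (hi : i * i = a • 1) (hj : j * j = b • 1) (hji : j * i = - (i * j)) {c0 c1 : D}
    (h0 : j * c0 = c0 * j) (h1 : j * c1 = c1 * j) (h : c0 + c1 * i = 0) : c0 = 0 ∧ c1 = 0 := by
  have e : (c0 - c1 * i) * j = 0 := by
    have : j * (c0 + c1 * i) = 0 := by rw [h, mul_zero]
    rw [← this, sub_mul, mul_add, h0, ← mul_assoc, h1, mul_assoc c1 j i, hji]
    noncomm_ring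
  have e2 := unit_of_sq hb hj e
  have h3 : c0 = 0 := by
    apply two_cancel hF
    calc c0 + c0 = (c0 + c1 * i) + (c0 - c1 * i) := by abel
      _ = 0 := by rw [h, e2, add_zero]
  refine ⟨h3, unit_of_sq ha hi ?_⟩
  rw [h3, zero_add] at h; exact h

lemma quat_indep (hF : (2:F) ≠ 0) {a b : F} {i j : D} (ha : a ≠ 0) (hb : b ≠ 0)
    (hi : i * i = a • 1) (hj : j * j = b • 1) (hji : j * i = - (i * j)) {c0 c1 c2 c3 : D}
    (h0 : j * c0 = c0 * j) (h1 : j * c1 = c1 * j) (h2 : j * c2 = c2 * j) (h3 : j * c3 = c3 * j)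
    (k0 : i * c0 = c0 * i) (k1 : i * c1 = c1 * i) (k2 : i * c2 = c2 * i) (k3 : i * c3 = c3 * i)
    (h : c0 + c1 * i + c2 * j + c3 * (i * j) = 0) : c0 = 0 ∧ c1 = 0 ∧ c2 = 0 ∧ c3 = 0 := by
  have hij : i * j = - (j * i) := by rw [hji, neg_neg]
  have e : (c0 + c1 * i) + (c2 + c3 * i) * j = 0 := by rw [← h]; noncomm_ring
  have := quat_indep_half hF hb ha hj hi hij (c0 := c0 + c1 * i) (c1 := c2 + c3 * i)
    (by rw [mul_add, add_mul, k0, ← mul_assoc, k1])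
    (by rw [mul_add, add_mul, k2, ← mul_assoc, k3]) e
  obtain ⟨e1, e2⟩ := this
  obtain ⟨x0, x1⟩ := quat_indep_half hF ha hb hi hj hji h0 h1 e1
  obtain ⟨x2, x3⟩ := quat_indep_half hF ha hb hi hj hji h2 h3 e2
  exact ⟨x0, x1, x2, x3⟩

/-- quaternion basis from a pair -/
def mkBasis {a b : F} {i j : D} (hi : i * i = a • 1) (hj : j * j = b • 1)
    (hji : j * i = - (i * j)) : QuaternionAlgebra.Basis D a 0 b where
  i := i
  j := j
  k := i * j
  i_mul_i := by simp [hi]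
  j_mul_j := hj
  i_mul_j := rfl
  j_mul_i := by simp [hji]

lemma mkBasis_liftHom {a b : F} {i j : D} (hi : i * i = a • 1) (hj : j * j = b • 1)
    (hji : j * i = - (i * j)) (q : ℍ[F,a,b]) :
    (mkBasis hi hj hji).liftHom q =
      algebraMap F D q.re + q.imI • i + q.imJ • j + q.imK • (i * j) := by
  rfl

lemma liftHom_inj [Nontrivial D] (hF : (2:F) ≠ 0) {a b : F} {i j : D} (ha : a ≠ 0) (hb : b ≠ 0)
    (hi : i * i = a • 1) (hj : j * j = b • 1) (hji : j * i = - (i * j)) (q : ℍ[F,a,b])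
    (h : (mkBasis hi hj hji).liftHom q = 0) : q = 0 := by
  rw [mkBasis_liftHom] at h
  simp only [Algebra.smul_def] at h
  obtain ⟨h0, h1, h2, h3⟩ := quat_indep hF ha hb hi hj hji (Algebra.commutes _ _).symm
    (Algebra.commutes _ _).symm (Algebra.commutes _ _).symm (Algebra.commutes _ _).symm
    (Algebra.commutes _ _).symm
    (Algebra.commutes _ _).symm (Algebra.commutes _ _).symm (Algebra.commutes _ _).symm h
  rw [map_eq_zero_iff _ (algebraMap F D).injective] at h0 h1 h2 h3
  ext <;> simp [h0, h1, h2, h3]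

lemma tensor_form {a b : F} {E : Type} [Ring E] [Algebra F E] (x : E ⊗[F] ℍ[F,a,b]) :
    ∃ h0 h1 h2 h3 : E, x = h0 ⊗ₜ 1 + h1 ⊗ₜ ⟨0,1,0,0⟩ + h2 ⊗ₜ ⟨0,0,1,0⟩ + h3 ⊗ₜ ⟨0,0,0,1⟩ := by
  induction x using TensorProduct.induction_on with
  | zero => exact ⟨0, 0, 0, 0, by simp⟩
  | tmul e q =>
    refine ⟨q.re • e, q.imI • e, q.imJ • e, q.imK • e, ?_⟩
    simp only [TensorProduct.smul_tmul, ← TensorProduct.tmul_add]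
    congr 1
    ext <;> simp
  | add x y hx hy =>
    obtain ⟨h0, h1, h2, h3, rfl⟩ := hx
    obtain ⟨g0, g1, g2, g3, rfl⟩ := hy
    refine ⟨h0 + g0, h1 + g1, h2 + g2, h3 + g3, ?_⟩
    simp only [TensorProduct.add_tmul]; abel

lemma liftHom_commutes {a b : F} {i j : D} (hi : i * i = a • 1) (hj : j * j = b • 1)
    (hji : j * i = - (i * j)) (q : ℍ[F,a,b]) {c : D} (ci : i * c = c * i) (cj : j * c = c * j) :
    (mkBasis hi hj hji).liftHom q * c = c * (mkBasis hi hj hji).liftHom q := by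
  rw [mkBasis_liftHom]
  simp only [add_mul, mul_add, Algebra.commutes, smul_mul_assoc, mul_smul_comm, ci, cj]
  rw [mul_assoc i j c, cj, ← mul_assoc, ci, mul_assoc]

lemma biquat_equiv [FiniteDimensional F D] (hF : (2:F) ≠ 0) (hD : Module.finrank F D = 16)
    (h : BiQuat F D) :
    ∃ (a b a' b' : F), a ≠ 0 ∧ b ≠ 0 ∧ a' ≠ 0 ∧ b' ≠ 0 ∧
      Nonempty (D ≃ₐ[F] ℍ[F,a,b] ⊗[F] ℍ[F,a',b']) := by
  obtain ⟨a, b, a', b', i, j, i', j', ha, hb, ha', hb', hi, hj, hji, hi', hj', hji',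
    c1, c2, c3, c4⟩ := h
  have : Nontrivial D := by
    apply Module.nontrivial_of_finrank_pos (R := F); omega
  refine ⟨a, b, a', b', ha, hb, ha', hb', ?_⟩
  set B1 := mkBasis hi hj hji with hB1
  set B2 := mkBasis hi' hj' hji' with hB2
  let φ : ℍ[F,a,b] ⊗[F] ℍ[F,a',b'] →ₐ[F] D := Algebra.TensorProduct.lift B1.liftHom B2.liftHom
    (fun q r => by
      have e1 : i * B2.liftHom r = B2.liftHom r * i :=
        (liftHom_commutes hi' hj' hji' r c1.symm c2.symm).symm
      have e2 : j * B2.liftHom r = B2.liftHom r * j :=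
        (liftHom_commutes hi' hj' hji' r c3.symm c4.symm).symm
      exact liftHom_commutes hi hj hji q e1 e2)
  have hinj : Function.Injective φ := by
    rw [injective_iff_map_eq_zero]
    intro x hx
    obtain ⟨h0, h1, h2, h3, rfl⟩ := tensor_form x
    have hform : B1.liftHom h0 + B1.liftHom h1 * i' + B1.liftHom h2 * j' +
        B1.liftHom h3 * (i' * j') = 0 := by
      rw [← hx]
      have tm : ∀ q r, φ (q ⊗ₜ r) = B1.liftHom q * B2.liftHom r := fun q r =>
        Algebra.TensorProduct.lift_tmul _ _ _ q r
      have t1 : B2.liftHom ⟨0,1,0,0⟩ = i' := by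
        rw [hB2, mkBasis_liftHom]; simp
      have t2 : B2.liftHom ⟨0,0,1,0⟩ = j' := by
        rw [hB2, mkBasis_liftHom]; simp
      have t3 : B2.liftHom ⟨0,0,0,1⟩ = i' * j' := by
        rw [hB2, mkBasis_liftHom]; simp
      rw [map_add, map_add, map_add, tm, tm, tm, tm, t1, t2, t3, map_one, mul_one]
    have ki := fun q => (liftHom_commutes hi hj hji q c1 c3).symm
    have kj := fun q => (liftHom_commutes hi hj hji q c2 c4).symm
    obtain ⟨x0, x1, x2, x3⟩ := quat_indep hF ha' hb' hi' hj' hji' (kj _) (kj _) (kj _) (kj _)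
      (ki _) (ki _) (ki _) (ki _) hform
    have z := fun q hq => liftHom_inj hF ha hb hi hj hji q hq
    rw [z _ x0, z _ x1, z _ x2, z _ x3]
    simp
  have hdim : Module.finrank F (ℍ[F,a,b] ⊗[F] ℍ[F,a',b']) = Module.finrank F D := by
    rw [Module.finrank_tensorProduct, QuaternionAlgebra.finrank_eq_four,
      QuaternionAlgebra.finrank_eq_four, hD]
  have hsurj : Function.Surjective φ :=
    (LinearMap.injective_iff_surjective_of_finrank_eq_finrank (f := φ.toLinearMap) hdim).mp hinj
  exact ⟨(AlgEquiv.ofBijective φ ⟨hinj, hsurj⟩).symm⟩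

end BiQ

section DivAlg

lemma finrank_map_inj {F V W : Type*} [Field F] [AddCommGroup V] [Module F V] [AddCommGroup W]
    [Module F W] (f : V →ₗ[F] W) (C : Submodule F V) (hf : Function.Injective f) :
    Module.finrank F (C.map f) = Module.finrank F C :=
  (Submodule.equivMapOfInjective f hf C).finrank_eq.symm

variable {F D : Type} [Field F]

/-- regular trace -/
noncomputable def rtr (F D : Type) [Field F] [Ring D] [Algebra F D] : D →ₗ[F] F :=
  (LinearMap.trace F D) ∘ₗ (LinearMap.mul F D)

lemma rtr_comm [Ring D] [Algebra F D] (x y : D) : rtr F D (x * y) = rtr F D (y * x) := by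
  have h : ∀ x y : D, LinearMap.mul F D (x * y) = LinearMap.mul F D x * LinearMap.mul F D y := by
    intro x y; ext z; simp [mul_assoc]
  simp only [rtr, LinearMap.comp_apply]
  rw [h, h, LinearMap.trace_mul_comm]

lemma rtr_one [Ring D] [Algebra F D] [FiniteDimensional F D] : rtr F D 1 = (Module.finrank F D : F) := by
  have : LinearMap.mul F D 1 = LinearMap.id := by ext z; simp
  simp only [rtr, LinearMap.comp_apply, this, LinearMap.trace_id]

lemma assoc_anti [Ring D] {x y : D} (h : y * x = -(x * y)) (z : D) :
    y * (x * z) = - (x * (y * z)) := by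
  rw [← mul_assoc, h, neg_mul, mul_assoc]

lemma assoc_sq [Ring D] [Algebra F D] {x : D} {a : F} (h : x * x = a • 1) (z : D) :
    x * (x * z) = a • z := by
  rw [← mul_assoc, h, smul_mul_assoc, one_mul]

lemma biquat_of_four [Ring D] [Algebra F D] {t1 t2 t3 t4 : D} {b1 b2 b3 b4 : F}
    (n1 : b1 ≠ 0) (n2 : b2 ≠ 0) (n3 : b3 ≠ 0) (n4 : b4 ≠ 0)
    (h1 : t1 * t1 = b1 • 1) (h2 : t2 * t2 = b2 • 1) (h3 : t3 * t3 = b3 • 1)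
    (h4 : t4 * t4 = b4 • 1) (a12 : t2 * t1 = -(t1 * t2)) (a13 : t3 * t1 = -(t1 * t3))
    (a14 : t4 * t1 = -(t1 * t4)) (a23 : t3 * t2 = -(t2 * t3)) (a24 : t4 * t2 = -(t2 * t4))
    (a34 : t4 * t3 = -(t3 * t4)) : BiQuat F D := by
  refine ⟨b1, b2, -(b1 * b2 * b3), -(b1 * b2 * b4), t1, t2, t1 * t2 * t3, t1 * t2 * t4, n1, n2,
    by simp [*], by simp [*], h1, h2, a12, ?_, ?_, ?_, ?_, ?_, ?_, ?_⟩ <;>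
  simp only [mul_assoc, h1, h2, h3, h4, a12, a13, a14, a23, a24, a34, assoc_anti a12,
    assoc_anti a13, assoc_anti a14, assoc_anti a23, assoc_anti a24, assoc_anti a34, assoc_sq h1,
    assoc_sq h2, assoc_sq h3, assoc_sq h4, mul_neg, neg_mul, neg_neg, mul_smul_comm,
    smul_mul_assoc, smul_neg, smul_smul, mul_one, one_mul, neg_smul] <;>
  try (congr 2; ring)

variable [DivisionRing D] [Algebra F D]

lemma two_mul_finrank_centralizer [FiniteDimensional F D] {t y : D} (h : t * y ≠ y * t)
    (C : Submodule F D) (hC : ∀ c ∈ C, t * c = c * t) :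
    2 * Module.finrank F C ≤ Module.finrank F D := by
  have hy : y ≠ 0 := by rintro rfl; simp at h
  have inj : Function.Injective (LinearMap.mulRight F y) := by
    intro a b hab
    simpa [hy] using hab
  have e : Module.finrank F (C.map (LinearMap.mulRight F y)) = Module.finrank F C :=
    finrank_map_inj _ _ inj
  have hd : Disjoint C (C.map (LinearMap.mulRight F y)) := by
    rw [Submodule.disjoint_def]
    rintro _ hx ⟨c, hc, rfl⟩
    simp only [LinearMap.mulRight_apply] at *
    by_contra hne
    have hc0 : c ≠ 0 := by rintro rfl; simp at hne
    have h1 := hC _ hx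
    rw [← mul_assoc, hC c hc, mul_assoc, mul_assoc] at h1
    exact h (mul_left_cancel₀ hc0 h1)
  have := Submodule.finrank_add_finrank_le_of_disjoint hd
  omega

lemma central_scalar [Algebra.IsCentral F D] {t : D} (h : ∀ y, t * y = y * t) :
    ∃ c : F, t = c • 1 := by
  have : t ∈ Subalgebra.center F D := by
    rw [Subalgebra.mem_center_iff]; intro y; exact (h y).symm
  rw [Algebra.IsCentral.center_eq_bot F D, Algebra.mem_bot] at this
  obtain ⟨c, rfl⟩ := this
  exact ⟨c, by rw [Algebra.algebraMap_eq_smul_one]⟩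

lemma exists_anticomm {t : D} {b : F} (hb : t * t = b • 1) {y : D} (hy : t * y ≠ y * t) :
    ∃ z : D, z ≠ 0 ∧ t * z = - (z * t) := by
  refine ⟨t * y - y * t, sub_ne_zero.mpr hy, ?_⟩
  rw [mul_sub, sub_mul, ← mul_assoc, hb, mul_assoc y t t, hb]
  simp [mul_assoc]

lemma rtr_eq_zero (hF : (2:F) ≠ 0) {t : D} {b : F} (hb : t * t = b • 1) {y : D}
    (hy : t * y ≠ y * t) : rtr F D t = 0 := by
  obtain ⟨z, hz, hz2⟩ := exists_anticomm hb hy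
  have h1 : rtr F D (z⁻¹ * (t * z)) = rtr F D t := by
    rw [rtr_comm, mul_assoc, mul_inv_cancel₀ hz, mul_one]
  rw [hz2, mul_neg, ← mul_assoc, inv_mul_cancel₀ hz, one_mul, map_neg] at h1
  have : 2 * rtr F D t = 0 := by linear_combination -h1
  exact (mul_eq_zero.mp this).resolve_left hF

lemma finrank_span_pair' [FiniteDimensional F D] {t y : D} (h : t * y ≠ y * t) :
    2 ≤ Module.finrank F (Submodule.span F {1, t}) := by
  have h1 : Module.finrank F (Submodule.span F {(1:D)}) = 1 := finrank_span_singleton one_ne_zero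
  have lt : Submodule.span F {(1:D)} < Submodule.span F {1, t} := by
    refine lt_of_le_of_ne (Submodule.span_mono (by simp)) ?_
    intro he
    have : t ∈ Submodule.span F {(1:D)} := by rw [he]; exact Submodule.subset_span (by simp)
    obtain ⟨c, rfl⟩ := Submodule.mem_span_singleton.mp this
    simp at h
  have := Submodule.finrank_lt_finrank_of_lt lt
  omega

lemma quat_of_finrank_four (hF : (2:F) ≠ 0) [FiniteDimensional F D] [Algebra.IsCentral F D]
    (hD : Module.finrank F D = 4) :
    ∃ (a b : F) (i j : D), a ≠ 0 ∧ b ≠ 0 ∧ i * i = a • 1 ∧ j * j = b • 1 ∧ j * i = -(i * j) := by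
  have hquad : ∀ x y z : D, x * z ≠ z * x → x * y = y * x → ∃ α β : F, y = α • 1 + β • x := by
    intro x y z hz hy
    have h1 := finrank_span_pair' (F := F) hz
    let C : Submodule F D := Subalgebra.toSubmodule (Subalgebra.centralizer F {x})
    have hC : ∀ c, c ∈ C ↔ x * c = c * x := by
      intro c; simp [C, Subalgebra.mem_centralizer_iff]
    have h2 := two_mul_finrank_centralizer hz C (fun c hc => (hC c).mp hc)
    have h3 : Submodule.span F {1, x} ≤ C := by
      rw [Submodule.span_le]
      rintro c (rfl | rfl)
      · exact (hC _).mpr (by simp)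
      · exact (hC _).mpr rfl
    have h4 := Submodule.eq_of_le_of_finrank_le h3 (by omega)
    have h5 : y ∈ C := (hC y).mpr hy
    rw [← h4, Submodule.mem_span_pair] at h5
    obtain ⟨α, β, h⟩ := h5
    exact ⟨α, β, h.symm⟩
  have hx : ∃ x y : D, x * y ≠ y * x := by
    by_contra hcon
    push Not at hcon
    have : (⊤ : Submodule F D) ≤ Submodule.span F {(1:D)} := by
      intro x _
      obtain ⟨c, rfl⟩ := central_scalar (F := F) (hcon x)
      exact Submodule.mem_span_singleton.mpr ⟨c, rfl⟩
    have h1 := Submodule.finrank_mono this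
    rw [finrank_top, finrank_span_singleton one_ne_zero] at h1
    omega
  obtain ⟨x, y, hxy⟩ := hx
  obtain ⟨β, α, hq⟩ := hquad x (x * x) y hxy (mul_assoc _ _ _).symm
  set i : D := x - (α / 2) • 1 with hi
  have hiy : i * y ≠ y * i := by
    simpa [hi, sub_mul, mul_sub] using hxy
  have hii : i * i = (β + α ^ 2 / 4) • 1 := by
    have h4 : (4:F) = 2 * 2 := by norm_num
    simp only [hi, sub_mul, mul_sub, hq, smul_mul_assoc, mul_smul_comm, one_mul, mul_one, h4]
    match_scalars <;> field_simp <;> ring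
  obtain ⟨j, hj0, hj⟩ := exists_anticomm hii hiy
  have hi0 : i ≠ 0 := by intro h; simp [h] at hiy
  obtain ⟨c, d, hjj⟩ := hquad i (j * j) y hiy (by
    rw [← mul_assoc, hj, neg_mul, mul_assoc, hj]; simp [mul_assoc])
  have hd : d = 0 := by
    have h1 : j * (j * j) = (j * j) * j := by rw [mul_assoc]
    rw [hjj] at h1
    simp only [mul_add, add_mul, mul_smul_comm, smul_mul_assoc, mul_one, one_mul, hj,
      add_right_inj] at h1
    have h2 : (2 * d) • (j * i) = 0 := by
      rw [two_mul, add_smul]; nth_rewrite 1 [h1]; simp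
    rcases smul_eq_zero.mp h2 with h | h
    · exact (mul_eq_zero.mp h).resolve_left hF
    · exact absurd h (mul_ne_zero hj0 hi0)
  rw [hd, zero_smul, add_zero] at hjj
  refine ⟨_, c, i, j, ?_, ?_, hii, hjj, by rw [hj, neg_neg]⟩
  · intro h; rw [h, zero_smul] at hii; exact hi0 (mul_self_eq_zero.mp hii)
  · intro h; rw [h, zero_smul] at hjj; exact hj0 (mul_self_eq_zero.mp hjj)

lemma symplectic_quadratic (hF : (2:F) ≠ 0) [FiniteDimensional F D] [Algebra.IsCentral F D]
    (hD : Module.finrank F D = 16) (γ : D →ₗ[F] D) (hγ : IsInvolution F D γ)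
    (h6 : Module.finrank F (symmElements F D γ) = 6) (t : D) (ht : γ t = t) :
    ∃ α β : F, t * t = α • 1 + β • t := by
  by_contra hcon
  have hK : Module.finrank F (skewElements F D γ) = 10 := by
    have := finrank_sym_skew hF γ hγ.2; omega
  have hnc : ∃ y, t * y ≠ y * t := by
    by_contra hc
    push Not at hc
    obtain ⟨c, rfl⟩ := central_scalar (F := F) hc
    exact hcon ⟨c * c, 0, by simp [smul_smul]⟩
  obtain ⟨y, hy⟩ := hnc
  set N := Submodule.span F {1, t, t * t} with hN
  have hN3 : 3 ≤ Module.finrank F N := by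
    have h1 := finrank_span_pair' (F := F) hy
    have lt : Submodule.span F {1, t} < N := by
      refine lt_of_le_of_ne (Submodule.span_mono ?_) ?_
      · intro x hx; simp at hx ⊢; tauto
      · intro he
        have : t * t ∈ Submodule.span F {1, t} := by
          rw [he]; exact Submodule.subset_span (by simp)
        rw [Submodule.mem_span_pair] at this
        obtain ⟨α, β, h⟩ := this
        exact hcon ⟨α, β, h.symm⟩
    have := Submodule.finrank_lt_finrank_of_lt lt
    omega
  have hNT : N ≤ symmElements F D γ := by
    rw [hN, Submodule.span_le]
    rintro c (rfl | rfl | rfl) <;> simp only [SetLike.mem_coe, mem_symmElements]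
    · exact hγ.map_one'
    · exact ht
    · rw [hγ.1, ht]
  have hNC : ∀ c ∈ N, t * c = c * t := by
    let C : Submodule F D := Subalgebra.toSubmodule (Subalgebra.centralizer F {t})
    have hC : ∀ c, c ∈ C ↔ t * c = c * t := by
      intro c; simp [C, Subalgebra.mem_centralizer_iff]
    intro c hc
    rw [← hC]
    refine (show N ≤ C from ?_) hc
    rw [hN, Submodule.span_le]
    rintro c (rfl | rfl | rfl) <;> simp only [SetLike.mem_coe, hC]
    · simp
    · rw [mul_assoc]
  let ad : D →ₗ[F] D := LinearMap.mulLeft F t - LinearMap.mulRight F t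
  have had : ∀ x, ad x = t * x - x * t := fun x => rfl
  let K := skewElements F D γ
  let adK := ad.domRestrict K
  have hrn := LinearMap.finrank_range_add_finrank_ker adK
  have hr : Module.finrank F (LinearMap.range adK) ≤ 3 := by
    have hle : LinearMap.range adK ≤ symmElements F D γ := by
      rintro _ ⟨⟨k, hk⟩, rfl⟩
      rw [mem_symmElements]
      have hk' := mem_skewElements.mp hk
      change γ (t * k - k * t) = t * k - k * t
      rw [map_sub, hγ.1, hγ.1, ht, hk']
      noncomm_ring
    have hdis : Disjoint (LinearMap.range adK) N := by
      rw [Submodule.disjoint_def]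
      rintro _ ⟨⟨k, hk⟩, rfl⟩ hm
      change t * k - k * t ∈ N at hm
      change t * k - k * t = 0
      by_contra hne
      set m := t * k - k * t with hmdef
      have hc := hNC m hm
      have hc2 : m⁻¹ * t = t * m⁻¹ := by
        have : m * (m⁻¹ * t) = m * (t * m⁻¹) := by
          rw [← mul_assoc, mul_inv_cancel₀ hne, one_mul, ← mul_assoc, ← hc, mul_assoc,
            mul_inv_cancel₀ hne, mul_one]
        exact mul_left_cancel₀ hne this
      have h1 : t * (k * m⁻¹) - (k * m⁻¹) * t = 1 := by
        rw [mul_assoc, hc2, ← mul_assoc, ← mul_assoc, ← sub_mul, ← hmdef, mul_inv_cancel₀ hne]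
      have h2 := congrArg (rtr F D) h1
      rw [map_sub, rtr_comm, sub_self, rtr_one, hD] at h2
      have h16 : (2:F) ^ 4 = 0 := by push_cast at h2; rw [h2]; norm_num
      exact hF (pow_eq_zero_iff (by norm_num) |>.mp h16)
    have h9 := Submodule.finrank_sup_add_finrank_inf_eq (LinearMap.range adK) N
    rw [hdis.eq_bot, finrank_bot] at h9
    have h1 := Submodule.finrank_mono (sup_le hle hNT)
    omega
  have hker : 7 ≤ Module.finrank F (LinearMap.ker adK) := by
    have : Module.finrank F K = 10 := hK
    omega
  let M := (LinearMap.ker adK).map K.subtype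
  have hM : Module.finrank F M = Module.finrank F (LinearMap.ker adK) :=
    finrank_map_inj _ _ K.injective_subtype
  have hMC : ∀ c ∈ M, t * c = c * t := by
    rintro _ ⟨c, hc, rfl⟩
    have : ad c = 0 := hc
    rw [had, sub_eq_zero] at this
    exact this
  have hdis : Disjoint M N := by
    have hMK : M ≤ K := Submodule.map_subtype_le _ _
    exact ((sym_skew_isCompl hF γ hγ.2).disjoint.symm.mono hMK hNT)
  have h8 := two_mul_finrank_centralizer hy (M ⊔ N) (by
    intro c hc
    obtain ⟨x, hx, z, hz, rfl⟩ := Submodule.mem_sup.mp hc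
    rw [mul_add, add_mul, hMC x hx, hNC z hz])
  have h9 := Submodule.finrank_sup_add_finrank_inf_eq M N
  rw [hdis.eq_bot, finrank_bot] at h9
  omega

end DivAlg

section DivAlg2

variable {F D : Type} [Field F] [DivisionRing D] [Algebra F D]

lemma symplectic_sq (hF : (2:F) ≠ 0) [FiniteDimensional F D] [Algebra.IsCentral F D]
    (hD : Module.finrank F D = 16) (γ : D →ₗ[F] D) (hγ : IsInvolution F D γ)
    (h6 : Module.finrank F (symmElements F D γ) = 6) (t : D) (ht : γ t = t)
    (htr : rtr F D t = 0) : ∃ β : F, t * t = β • 1 := by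
  have h16 : (Module.finrank F D : F) ≠ 0 := by
    rw [hD]
    intro h
    have : (2:F) ^ 4 = 0 := by push_cast at h; rw [← h]; norm_num
    exact hF (pow_eq_zero_iff (by norm_num) |>.mp this)
  by_cases hc : ∀ y, t * y = y * t
  · obtain ⟨c, rfl⟩ := central_scalar (F := F) hc
    exact ⟨c * c, by simp [smul_smul]⟩
  push Not at hc
  obtain ⟨y, hy⟩ := hc
  obtain ⟨β, α, hq⟩ := symplectic_quadratic hF hD γ hγ h6 t ht
  set i : D := t - (α / 2) • 1 with hi
  have hiy : i * y ≠ y * i := by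
    simpa [hi, sub_mul, mul_sub] using hy
  have hii : i * i = (β + α ^ 2 / 4) • 1 := by
    have h4 : (4:F) = 2 * 2 := by norm_num
    simp only [hi, sub_mul, mul_sub, hq, smul_mul_assoc, mul_smul_comm, one_mul, mul_one, h4]
    match_scalars <;> field_simp <;> ring
  have h0 := rtr_eq_zero hF hii hiy
  rw [hi, map_sub, htr, map_smul, rtr_one, zero_sub, neg_eq_zero, smul_eq_mul] at h0
  have : α = 0 := by
    rcases mul_eq_zero.mp h0 with h | h
    · rcases div_eq_zero_iff.mp h with h | h
      · exact h
      · exact absurd h hF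
    · exact absurd h h16
  refine ⟨β, ?_⟩
  rw [hq, this]; simp

lemma anti_step [FiniteDimensional F D] (U : Submodule F D)
    (hU : ∀ u ∈ U, ∃ β : F, u * u = β • 1) (t : D) (ht : t ∈ U) (V : Submodule F D) (hVU : V ≤ U)
    (n : ℕ) (hV : n + 1 ≤ Module.finrank F V) :
    ∃ V' : Submodule F D, V' ≤ V ∧ n ≤ Module.finrank F V' ∧ ∀ v ∈ V', v * t = - (t * v) := by
  let f : D →ₗ[F] D := LinearMap.mulLeft F t + LinearMap.mulRight F t
  have hf : ∀ x, f x = t * x + x * t := fun x => rfl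
  let g := f.domRestrict V
  have hrn := LinearMap.finrank_range_add_finrank_ker g
  have hr : Module.finrank F (LinearMap.range g) ≤ 1 := by
    have : LinearMap.range g ≤ Submodule.span F {(1:D)} := by
      rintro _ ⟨⟨v, hv⟩, rfl⟩
      change t * v + v * t ∈ _
      obtain ⟨b1, h1⟩ := hU t ht
      obtain ⟨b2, h2⟩ := hU v (hVU hv)
      obtain ⟨b3, h3⟩ := hU (t + v) (U.add_mem ht (hVU hv))
      rw [Submodule.mem_span_singleton]
      refine ⟨b3 - b1 - b2, ?_⟩
      rw [sub_smul, sub_smul, ← h1, ← h2, ← h3]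
      noncomm_ring
    have h := Submodule.finrank_mono this
    rwa [finrank_span_singleton one_ne_zero] at h
  refine ⟨(LinearMap.ker g).map V.subtype, Submodule.map_subtype_le _ _, ?_, ?_⟩
  · rw [finrank_map_inj _ _ V.injective_subtype]; omega
  · rintro _ ⟨c, hc, rfl⟩
    have : f c = 0 := hc
    rw [hf] at this
    exact eq_neg_of_add_eq_zero_right this

lemma exists_ne_zero_of_finrank (V : Submodule F D) (n : ℕ) (h : n + 1 ≤ Module.finrank F V) :
    ∃ v ∈ V, v ≠ 0 := by
  by_contra hc
  push Not at hc
  have : V = ⊥ := by rw [Submodule.eq_bot_iff]; exact hc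
  rw [this, finrank_bot] at h
  omega

lemma biquat_of_symplectic (hF : (2:F) ≠ 0) [FiniteDimensional F D] [Algebra.IsCentral F D]
    (hD : Module.finrank F D = 16) (γ : D →ₗ[F] D) (hγ : IsInvolution F D γ)
    (h6 : Module.finrank F (symmElements F D γ) = 6) : BiQuat F D := by
  let T := symmElements F D γ
  let g := (rtr F D).domRestrict T
  have hrn := LinearMap.finrank_range_add_finrank_ker g
  have hr : Module.finrank F (LinearMap.range g) ≤ 1 := by
    have := Submodule.finrank_le (LinearMap.range g)
    rwa [Module.finrank_self] at this
  let U := (LinearMap.ker g).map T.subtype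
  have hU5 : 4 + 1 ≤ Module.finrank F U := by
    rw [finrank_map_inj _ _ T.injective_subtype]
    have : Module.finrank F T = 6 := h6
    omega
  have hU : ∀ u ∈ U, ∃ β : F, u * u = β • 1 := by
    rintro _ ⟨c, hc, rfl⟩
    have : rtr F D c = 0 := hc
    exact symplectic_sq hF hD γ hγ h6 _ (mem_symmElements.mp c.2) this
  obtain ⟨t1, ht1, z1⟩ := exists_ne_zero_of_finrank U _ hU5
  obtain ⟨V2, l2, d2, c2⟩ := anti_step U hU t1 ht1 U le_rfl 4 hU5
  obtain ⟨t2, ht2, z2⟩ := exists_ne_zero_of_finrank V2 3 d2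
  obtain ⟨V3, l3, d3, c3⟩ := anti_step U hU t2 (l2 ht2) V2 l2 3 d2
  obtain ⟨t3, ht3, z3⟩ := exists_ne_zero_of_finrank V3 2 d3
  obtain ⟨V4, l4, d4, c4⟩ := anti_step U hU t3 (l2 (l3 ht3)) V3 (l3.trans l2) 2 d3
  obtain ⟨t4, ht4, z4⟩ := exists_ne_zero_of_finrank V4 1 d4
  obtain ⟨b1, q1⟩ := hU t1 ht1
  obtain ⟨b2, q2⟩ := hU t2 (l2 ht2)
  obtain ⟨b3, q3⟩ := hU t3 (l2 (l3 ht3))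
  obtain ⟨b4, q4⟩ := hU t4 (l2 (l3 (l4 ht4)))
  have nz : ∀ (t : D) (b : F), t ≠ 0 → t * t = b • 1 → b ≠ 0 := by
    rintro t b ht h rfl
    rw [zero_smul] at h
    exact ht (mul_self_eq_zero.mp h)
  exact biquat_of_four (nz _ _ z1 q1) (nz _ _ z2 q2) (nz _ _ z3 q3) (nz _ _ z4 q4) q1 q2 q3 q4
    (c2 _ ht2) (c2 _ (l3 ht3)) (c2 _ (l3 (l4 ht4))) (c3 _ ht3) (c3 _ (l4 ht4)) (c4 _ ht4)

lemma biquat_div (hF : (2:F) ≠ 0) [FiniteDimensional F D] [Algebra.IsCentral F D]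
    (hD : Module.finrank F D = 16) (θ : D →ₗ[F] D) (hθ : IsInvolution F D θ)
    (h10 : Module.finrank F (symmElements F D θ) = 10) : BiQuat F D := by
  have hK : Module.finrank F (skewElements F D θ) = 5 + 1 := by
    have := finrank_sym_skew hF θ hθ.2; omega
  obtain ⟨s, hs, s0⟩ := exists_ne_zero_of_finrank _ _ hK.ge
  rw [mem_skewElements] at hs
  let γ : D →ₗ[F] D := LinearMap.mulRight F s⁻¹ ∘ₗ LinearMap.mulLeft F s ∘ₗ θ
  have hγ : ∀ x, γ x = s * θ x * s⁻¹ := fun x => rfl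
  have hθi : θ s⁻¹ = - s⁻¹ := by
    have h1 : θ s⁻¹ * θ s = 1 := by
      rw [← hθ.1, mul_inv_cancel₀ s0, hθ.map_one']
    rw [hs] at h1
    have h2 : (- θ s⁻¹) * s = 1 := by rw [← h1]; simp
    have := eq_inv_of_mul_eq_one_left h2
    exact neg_eq_iff_eq_neg.mp this
  have hinv : IsInvolution F D γ := by
    constructor
    · intro x y
      rw [hγ, hγ, hγ, hθ.1]
      simp only [mul_assoc]
      rw [inv_mul_cancel_left₀ s0]
    · intro x
      rw [hγ, hγ, hθ.1, hθ.1, hθ.2, hs, hθi]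
      simp only [mul_assoc, neg_mul, mul_neg, neg_neg]
      rw [mul_inv_cancel_left₀ s0, mul_inv_cancel₀ s0, mul_one]
  have h6 : Module.finrank F (symmElements F D γ) = 6 := by
    have inj : Function.Injective (LinearMap.mulRight F s) := by
      intro a b hab
      simpa [s0] using hab
    have : (symmElements F D γ).map (LinearMap.mulRight F s) = skewElements F D θ := by
      ext x
      constructor
      · rintro ⟨y, hy, rfl⟩
        have hy' := mem_symmElements.mp hy
        rw [hγ] at hy'
        rw [mem_skewElements, LinearMap.mulRight_apply, hθ.1, hs]
        nth_rewrite 2 [← hy']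
        rw [mul_assoc, inv_mul_cancel₀ s0, mul_one, neg_mul]
      · intro hx
        rw [mem_skewElements] at hx
        refine ⟨x * s⁻¹, mem_symmElements.mpr ?_, ?_⟩
        · rw [hγ, hθ.1, hx, hθi, neg_mul_neg, mul_inv_cancel_left₀ s0]
        · simp [mul_assoc, inv_mul_cancel₀ s0]
    rw [← finrank_map_inj _ _ inj, this, hK]
  exact biquat_of_symplectic hF hD γ hinv h6

end DivAlg2

section MatBQ

variable {F : Type} [Field F] 

lemma biquat_matrix_quat {D : Type} [Ring D] [Algebra F D] {a b : F} {i j : D}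
    (ha : a ≠ 0) (hb : b ≠ 0) (hi : i * i = a • 1) (hj : j * j = b • 1)
    (hji : j * i = -(i * j)) : BiQuat F (Matrix (Fin 2) (Fin 2) D) := by
  refine ⟨1, 1, a, b, !![1, 0; 0, -1], !![0, 1; 1, 0], !![i, 0; 0, i], !![j, 0; 0, j],
    one_ne_zero, one_ne_zero, ha, hb, ?_, ?_, ?_, ?_, ?_, ?_, ?_, ?_, ?_, ?_⟩ <;>
  ext r c <;> fin_cases r <;> fin_cases c <;> simp [Matrix.mul_apply, Fin.sum_univ_two, hi, hj, hji]

lemma biquat_of_equiv {D E : Type} [Ring D] [Algebra F D] [Ring E] [Algebra F E]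
    (e : D ≃ₐ[F] E) (h : BiQuat F D) : BiQuat F E := by
  obtain ⟨a, b, a', b', i, j, i', j', ha, hb, ha', hb', h1, h2, h3, h4, h5, h6, h7, h8, h9, h10⟩ := h
  refine ⟨a, b, a', b', e i, e j, e i', e j', ha, hb, ha', hb', ?_, ?_, ?_, ?_, ?_, ?_, ?_, ?_,
    ?_, ?_⟩ <;> simp only [← map_mul, *] <;> simp

lemma biquat_matrix_four {D : Type} [Ring D] [Algebra F D] :
    BiQuat F (Matrix (Fin 4) (Fin 4) D) := by
  have h : BiQuat F (Matrix (Fin 2) (Fin 2) (Matrix (Fin 2) (Fin 2) D)) := by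
    apply biquat_matrix_quat (a := 1) (b := 1) (i := !![1, 0; 0, -1]) (j := !![0, 1; 1, 0])
      one_ne_zero one_ne_zero <;>
    ext r c <;> fin_cases r <;> fin_cases c <;> simp [Matrix.mul_apply, Fin.sum_univ_two]
  exact biquat_of_equiv ((Matrix.compAlgEquiv (Fin 2) (Fin 2) D F).trans
    (Matrix.reindexAlgEquiv F D finProdFinEquiv)) h

end MatBQ

section Idem

variable {F A : Type} [Field F] [Ring A] [Algebra F A]

/-- The left ideal `A P` as an `F`-subspace. -/
def Lid (F : Type) {A : Type} [Field F] [Ring A] [Algebra F A] (P : A) : Submodule F A :=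
  LinearMap.range (LinearMap.mulRight F P)

lemma mem_Lid {P x : A} (hP : P * P = P) : x ∈ Lid F P ↔ x * P = x := by
  constructor
  · rintro ⟨y, rfl⟩
    simp [mul_assoc, hP]
  · intro h; exact ⟨x, h⟩

lemma mul_mem_Lid (P x : A) : x * P ∈ Lid F P := ⟨x, rfl⟩

lemma Lid_le [FiniteDimensional F A] {P R x y : A} (hP : P * P = P) 
    (hxy : x * y = P) (hyx : y * x = R) :
    Module.finrank F (Lid F P) ≤ Module.finrank F (Lid F R) := by
  let f : Lid F P →ₗ[F] Lid F R :=
    LinearMap.codRestrict _ ((LinearMap.mulRight F x).domRestrict (Lid F P)) (by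
      rintro ⟨a, ha⟩
      rw [mem_Lid hP] at ha
      refine ⟨a * x, ?_⟩
      change a * x * R = a * x
      rw [← hyx, ← mul_assoc, mul_assoc a x y, hxy, ha])
  refine LinearMap.finrank_le_finrank_of_injective (f := f) ?_
  rintro ⟨a, ha⟩ ⟨b, hb⟩ h
  rw [mem_Lid hP] at ha hb
  have h1 : a * x = b * x := congrArg Subtype.val h
  ext
  change a = b
  rw [← ha, ← hb, ← hxy, ← mul_assoc, ← mul_assoc, h1]

lemma Lid_eq [FiniteDimensional F A] {P R x y : A} (hP : P * P = P) (hR : R * R = R)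
    (hxy : x * y = P) (hyx : y * x = R) :
    Module.finrank F (Lid F P) = Module.finrank F (Lid F R) :=
  le_antisymm (Lid_le hP hxy hyx) (Lid_le hR hyx hxy)

lemma Lid_add [FiniteDimensional F A] {P R : A} (hP : P * P = P) (hR : R * R = R)
    (hPR : P * R = 0) (hRP : R * P = 0) :
    Module.finrank F (Lid F (P + R)) = Module.finrank F (Lid F P) + Module.finrank F (Lid F R) := by
  have hd : Disjoint (Lid F P) (Lid F R) := by
    rw [Submodule.disjoint_def]
    intro x h1 h2
    rw [mem_Lid hP] at h1
    rw [mem_Lid hR, ← h1, mul_assoc, hPR, mul_zero] at h2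
    rw [← h1, ← h2]
  have hs : Lid F (P + R) = Lid F P ⊔ Lid F R := by
    apply le_antisymm
    · rintro _ ⟨y, rfl⟩
      simp only [LinearMap.mulRight_apply, mul_add]
      exact Submodule.add_mem_sup (mul_mem_Lid _ _) (mul_mem_Lid _ _)
    · have hPR2 : (P + R) * (P + R) = P + R := by
        simp [mul_add, add_mul, hP, hR, hPR, hRP]
      apply sup_le
      · intro x hx
        rw [mem_Lid hP] at hx
        rw [mem_Lid hPR2, mul_add, hx, ← hx, mul_assoc, hPR]; simp
      · intro x hx
        rw [mem_Lid hR] at hx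
        rw [mem_Lid hPR2, mul_add, hx, ← hx, mul_assoc, hRP]; simp
  have h9 := Submodule.finrank_sup_add_finrank_inf_eq (Lid F P) (Lid F R)
  rw [hd.eq_bot, finrank_bot, ← hs] at h9
  omega

lemma Lid_one : Lid F (1 : A) = ⊤ := by
  rw [Submodule.eq_top_iff']; intro x; exact ⟨x, by simp⟩

lemma ideal_iso [FiniteDimensional F A] [IsSimpleRing A] (M N : Submodule A A)
    (h : Module.finrank F M = Module.finrank F N) : Nonempty (M ≃ₗ[A] N) := by
  have : IsArtinianRing A := IsArtinianRing.of_finite F A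
  have hfin : ∀ (L : Submodule A A), FiniteDimensional F L := fun L =>
    (inferInstance : FiniteDimensional F (L.restrictScalars F))
  have hA : IsIsotypic A A := IsSimpleRing.isIsotypic A A
  obtain ⟨n, hn, S, hS, e⟩ := hA.linearEquiv_fun
  have hM : IsIsotypicOfType A M S := (hA S).of_injective M.subtype M.injective_subtype
  have hN : IsIsotypicOfType A N S := (hA S).of_injective N.subtype N.injective_subtype
  have fM : Module.Finite A M := Module.Finite.of_restrictScalars_finite F A M
  have fN : Module.Finite A N := Module.Finite.of_restrictScalars_finite F A N
  obtain ⟨a, ⟨ea⟩⟩ := hM.linearEquiv_fun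
  obtain ⟨b, ⟨eb⟩⟩ := hN.linearEquiv_fun
  have h1 := (ea.restrictScalars F).finrank_eq
  have h2 := (eb.restrictScalars F).finrank_eq
  have hS' := hfin S
  rw [Module.finrank_pi_fintype] at h1 h2
  simp only [Finset.sum_const, Finset.card_univ, Fintype.card_fin, smul_eq_mul] at h1 h2
  have hpos : 0 < Module.finrank F S := by
    have := hS.nontrivial
    exact Module.finrank_pos
  have hab : a = b := by
    have : a * Module.finrank F S = b * Module.finrank F S := by omega
    exact Nat.eq_of_mul_eq_mul_right hpos this
  subst hab
  exact ⟨ea.trans eb.symm⟩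

lemma idem_iso [FiniteDimensional F A] [IsSimpleRing A] {P R : A} (hP : P * P = P) (hR : R * R = R)
    (h : Module.finrank F (Lid F P) = Module.finrank F (Lid F R)) :
    ∃ x y : A, P * x = x ∧ x * R = x ∧ R * y = y ∧ y * P = y ∧ x * y = P ∧ y * x = R := by
  let I : A → Submodule A A := fun P => LinearMap.range (LinearMap.toSpanSingleton A A P)
  have hI : ∀ P, (I P).restrictScalars F = Lid F P := by
    intro P; ext x
    simp only [Submodule.restrictScalars_mem, I, LinearMap.mem_range, Lid]
    rfl
  have hI2 : ∀ P, Module.finrank F (I P) = Module.finrank F (Lid F P) := by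
    intro P
    rw [← hI P]; rfl
  have hmem : ∀ {P x : A}, P * P = P → (x ∈ I P ↔ x * P = x) := by
    intro P x hP
    rw [← mem_Lid (F := F) hP, ← hI]; rfl
  obtain ⟨φ⟩ := ideal_iso (F := F) (I P) (I R) (by rw [hI2, hI2, h])
  have hPm : P ∈ I P := (hmem hP).mpr hP
  have hRm : R ∈ I R := (hmem hR).mpr hR
  let p : I P := ⟨P, hPm⟩
  let r : I R := ⟨R, hRm⟩
  have hx : (φ p : A) * R = φ p := (hmem hR).mp (φ p).2
  have hy : (φ.symm r : A) * P = φ.symm r := (hmem hP).mp (φ.symm r).2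
  refine ⟨φ p, φ.symm r, ?_, hx, ?_, hy, ?_, ?_⟩
  · have : P • p = p := Subtype.ext hP
    have h2 := congrArg Subtype.val (φ.map_smul P p)
    rw [this] at h2
    exact h2.symm
  · have : R • r = r := Subtype.ext hR
    have h2 := congrArg Subtype.val (φ.symm.map_smul R r)
    rw [this] at h2
    exact h2.symm
  · have h1 : (φ p : A) • r = φ p := Subtype.ext hx
    have h2 := congrArg Subtype.val (φ.symm.map_smul (φ p : A) r)
    rw [h1, φ.symm_apply_apply] at h2
    exact h2.symm
  · have h1 : (φ.symm r : A) • p = φ.symm r := Subtype.ext hy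
    have h2 := congrArg Subtype.val (φ.map_smul (φ.symm r : A) p)
    rw [h1, φ.apply_symm_apply] at h2
    exact h2.symm

/-- Primitive full idempotent with division corner. -/
structure Prim (p : A) : Prop where
  idem : p * p = p
  gen : ∃ (m : ℕ) (r l : Fin m → A), ∑ i, r i * p * l i = 1
  div : ∀ z, p * z * p ≠ 0 → ∃ w, (p * w * p) * (p * z * p) = p

lemma Prim.left {p : A} (hp : Prim p) {a : A} (ha : a ≠ 0) : ∃ b, a * b * p ≠ 0 := by
  by_contra hc
  push Not at hc
  obtain ⟨m, r, l, h⟩ := hp.gen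
  apply ha
  rw [← mul_one a, ← h, Finset.mul_sum]
  apply Finset.sum_eq_zero
  intro i _
  rw [← mul_assoc, ← mul_assoc, hc, zero_mul]

lemma Prim.right {p : A} (hp : Prim p) {a : A} (ha : a ≠ 0) : ∃ b, p * b * a ≠ 0 := by
  by_contra hc
  push Not at hc
  obtain ⟨m, r, l, h⟩ := hp.gen
  apply ha
  rw [← one_mul a, ← h, Finset.sum_mul]
  apply Finset.sum_eq_zero
  intro i _
  rw [mul_assoc (r i), mul_assoc (r i), hc, mul_zero]

lemma Prim.transfer {p x y : A} (hp : Prim p) (hyx : y * x = p) (hx : x * p = x)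
    (hy : p * y = y) : Prim (x * y) := by
  have hidem := hp.idem
  refine ⟨by grind, ?_, ?_⟩
  · obtain ⟨m, r, l, h⟩ := hp.gen
    refine ⟨m, fun i => r i * y, fun i => x * l i, ?_⟩
    rw [← h]
    apply Finset.sum_congr rfl
    intro i _
    have : y * (x * y) * x = p := by grind
    calc r i * y * (x * y) * (x * l i) = r i * (y * (x * y) * x) * l i := by
          simp only [mul_assoc]
      _ = _ := by rw [this]
  · intro z hz
    have hz' : p * (y * z * x) * p ≠ 0 := by
      have : (x * y) * z * (x * y) = x * (p * (y * z * x) * p) * y := by grind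
      intro h
      apply hz
      rw [this, h]; simp
    obtain ⟨w, hw⟩ := hp.div _ hz'
    refine ⟨x * w * y, ?_⟩
    clear hz hz'
    have : (x * y) * (x * w * y) * (x * y) * ((x * y) * z * (x * y)) =
      x * ((p * w * p) * (p * (y * z * x) * p)) * y := by clear hw; grind
    rw [this, hw, hx]

end Idem

section SymPrim

variable {F A : Type} [Field F] [Ring A] [Algebra F A] 

lemma Prim.get_w {p q v : A} (hp : Prim p) (hvp : v * p = v) (hqv : q * v = v) (hq : q * q = q)
    (hv : v ≠ 0) : ∃ w, p * w = w ∧ w * q = w ∧ w * v = p := by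
  have hidem := hp.idem
  obtain ⟨b, hb⟩ := hp.right hv
  have e : p * (b * v) * p = p * b * v := by clear hb; grind
  rw [← e] at hb
  obtain ⟨w0, hw0⟩ := hp.div _ hb
  refine ⟨p * w0 * p * b * q, by simp only [← mul_assoc, hidem], by rw [mul_assoc, hq], ?_⟩
  rw [e] at hw0
  have e3 : p * w0 * p * b * q * v = p * w0 * p * (p * b * v) := by
    clear hw0 hb e
    grind
  rw [e3, hw0]

variable {σ : A →ₗ[F] A}

lemma sym_idem_of (hσ : IsInvolution F A σ) [FiniteDimensional F A] {p x : A} (hp : Prim p) (hx : x * p = x)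
    (hv : σ x * x ≠ 0) : ∃ w, σ (x * w * σ x) = x * w * σ x ∧
      (x * w * σ x) * (x * w * σ x) = x * w * σ x ∧ Prim (x * w * σ x) ∧
      Module.finrank F (Lid F (x * w * σ x)) = Module.finrank F (Lid F p) := by
  have hidem := hp.idem
  have hxp : σ p * σ x = σ x := by rw [← hσ.1, hx]
  have hpp : σ p * σ p = σ p := by rw [← hσ.1, hidem]
  obtain ⟨w, w1, w2, w3⟩ := hp.get_w (v := σ x * x) (q := σ p) (by rw [mul_assoc, hx])
    (by rw [← mul_assoc, hxp]) hpp hv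
  have hvv : σ (σ x * x) = σ x * x := by rw [hσ.1, hσ.2]
  have hw : σ w = w := by
    have h1 : σ x * x * σ w = σ p := by rw [← w3, hσ.1, hvv]
    have h2 : σ w = p * σ w := by
      nth_rewrite 1 [← w2]
      rw [hσ.1, hσ.2]
    rw [h2]
    nth_rewrite 2 [← w2]
    rw [← h1, ← mul_assoc, w3]
  have e1 : (w * σ x) * x = p := by rw [mul_assoc, w3]
  have e2 : p * (w * σ x) = w * σ x := by rw [← mul_assoc, w1]
  have e3 : (x * w * σ x) * (x * w * σ x) = x * w * σ x := by
    clear hw hpp hvv w2 hv hxp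
    grind
  refine ⟨w, ?_, e3, ?_, ?_⟩
  · rw [hσ.1, hσ.1, hσ.2, hw, mul_assoc]
  · rw [mul_assoc]
    exact hp.transfer e1 hx e2
  · exact Lid_eq e3 hidem (by rw [mul_assoc]) e1

lemma exists_sym_prim (hσ : IsInvolution F A σ) [FiniteDimensional F A] (hF : (2:F) ≠ 0)
    (h36 : 28 < Module.finrank F (symmElements F A σ)) {p : A} (hp : Prim p) (hp0 : p ≠ 0)
    (hcomm : (∀ z z', (p * z * p) * (p * z' * p) = (p * z' * p) * (p * z * p)) →
      Module.finrank F (Lid F p) = 8) :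
    ∃ p' : A, Prim p' ∧ σ p' = p' ∧ Module.finrank F (Lid F p') = Module.finrank F (Lid F p) := by
  have hidem := hp.idem
  by_cases hex : ∃ x, x * p = x ∧ σ x * x ≠ 0
  · obtain ⟨x, hx, hv⟩ := hex
    obtain ⟨w, h1, h2, h3, h4⟩ := sym_idem_of hσ hp hx hv
    exact ⟨_, h3, h1, h4⟩
  exfalso
  push Not at hex
  have hpol : ∀ x y, x * p = x → y * p = y → σ x * y + σ y * x = 0 := by
    intro x y hx hy
    have := hex (x + y) (by rw [add_mul, hx, hy])
    rw [map_add, add_mul, mul_add, mul_add, hex x hx, hex y hy] at this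
    rw [← this]; abel
  have hskew : ∀ a, σ (σ p * a * p) = - (σ p * a * p) := by
    intro a
    have := hpol p (a * p) hidem (by rw [mul_assoc, hidem])
    rw [hσ.1, hσ.1, hσ.2]
    rw [hσ.1] at this
    rw [← mul_assoc] at this ⊢
    exact eq_neg_of_add_eq_zero_right this
  have hsp0 : σ p ≠ 0 := by
    intro h
    have := hσ.2 p
    rw [h, map_zero] at this
    exact hp0 this.symm
  have hpp : σ p * σ p = σ p := by rw [← hσ.1, hidem]
  obtain ⟨a, ha⟩ := hp.left hsp0
  set v := σ p * a * p with hvdef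
  have hvp : v * p = v := by rw [hvdef, mul_assoc, hidem]
  have hpv : σ p * v = v := by rw [hvdef, ← mul_assoc, ← mul_assoc, hpp]
  obtain ⟨w, w1, w2, w3⟩ := hp.get_w hvp hpv hpp ha
  have hsv : σ v = - v := hskew a
  have hw : σ w = -w := by
    have h1 : v * σ w = - σ p := by
      rw [← w3, hσ.1, hsv]; simp
    have h2 : σ w = p * σ w := by
      nth_rewrite 1 [← w2]
      rw [hσ.1, hσ.2]
    rw [h2, ← w3, mul_assoc, h1, mul_neg, w2]
  have hvd : ∀ d, v * (p * d * p) = σ (p * d * p) * v := by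
    intro d
    have h1 := hskew (v * (p * d * p))
    have h2 : σ p * (v * (p * d * p)) * p = v * (p * d * p) := by
      rw [← mul_assoc, hpv, mul_assoc, mul_assoc (p * d), hidem]
    rw [h2, hσ.1, hsv, mul_neg, neg_inj] at h1
    exact h1.symm
  have h8 := hcomm (by
    intro z z'
    have e : v * ((p * z * p) * (p * z' * p)) = v * ((p * z' * p) * (p * z * p)) := by
      have h1 := hvd (z' * p * p * z)
      have h2 : p * (z' * p * p * z) * p = (p * z' * p) * (p * z * p) := by
        simp only [mul_assoc]
      rw [h2] at h1
      rw [h1, ← mul_assoc, hvd, mul_assoc, hvd, ← mul_assoc, ← hσ.1]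
    have e2 : w * (v * ((p * z * p) * (p * z' * p))) = w * (v * ((p * z' * p) * (p * z * p))) := by
      rw [e]
    rw [← mul_assoc, ← mul_assoc w v, w3] at e2
    simpa only [← mul_assoc, hidem] using e2)
  let b := Module.finBasisOfFinrankEq F (Lid F p) h8
  let L1 : A →ₗ[F] A →ₗ[F] A := (LinearMap.mul F A).compl₁₂ (LinearMap.mulRight F w) σ
  let B := L1 - L1.flip
  have hB : ∀ x y, B x y = x * w * σ y - y * w * σ x := fun x y => rfl
  let G : Submodule F A := Submodule.span F
    (Set.range fun ij : {ij : Fin 8 × Fin 8 // ij.1 < ij.2} => B (b ij.1.1) (b ij.1.2))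
  have hG : Module.finrank F G ≤ 28 := by
    refine (finrank_range_le_card _).trans ?_
    decide
  have hbG : ∀ i j, B (b i) (b j) ∈ G := by
    intro i j
    rcases lt_trichotomy i j with h | h | h
    · exact Submodule.subset_span ⟨⟨(i, j), h⟩, rfl⟩
    · rw [h, hB, sub_self]; exact G.zero_mem
    · have h1 : B (b j) (b i) ∈ G := Submodule.subset_span ⟨⟨(j, i), h⟩, rfl⟩
      have h2 : B (b i) (b j) = - B (b j) (b i) := by rw [hB, hB, neg_sub]
      rw [h2]; exact G.neg_mem h1
  have hBG : ∀ x y, x ∈ Lid F p → y ∈ Lid F p → B x y ∈ G := by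
    intro x y hx hy
    have ex : x = ∑ i, b.repr ⟨x, hx⟩ i • (b i : A) := by
      have := congrArg (Lid F p).subtype (b.sum_repr ⟨x, hx⟩)
      rw [map_sum] at this
      exact this.symm
    have ey : y = ∑ i, b.repr ⟨y, hy⟩ i • (b i : A) := by
      have := congrArg (Lid F p).subtype (b.sum_repr ⟨y, hy⟩)
      rw [map_sum] at this
      exact this.symm
    rw [ex, ey, map_sum]
    refine G.sum_mem fun j _ => ?_
    rw [map_sum, LinearMap.sum_apply]
    refine G.sum_mem fun i _ => ?_
    rw [map_smul, map_smul, LinearMap.smul_apply]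
    exact G.smul_mem _ (G.smul_mem _ (hbG i j))
  have hall : ∀ a, a + σ a ∈ G := by
    intro a
    obtain ⟨m, r, l, h⟩ := hp.gen
    have ea : a = ∑ i, (a * r i * p) * w * σ (σ (v * l i)) := by
      nth_rewrite 1 [← mul_one a, ← h]
      rw [Finset.mul_sum]
      refine Finset.sum_congr rfl fun i _ => ?_
      rw [hσ.2, mul_assoc _ w, ← mul_assoc w, w3, ← mul_assoc (a * r i * p), mul_assoc (a * r i) p p, hidem]
      simp only [mul_assoc]
    have : a + σ a = ∑ i, B (a * r i * p) (σ (v * l i)) := by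
      nth_rewrite 1 [ea]
      nth_rewrite 2 [ea]
      rw [map_sum, ← Finset.sum_add_distrib]
      refine Finset.sum_congr rfl fun i _ => ?_
      rw [hB, hσ.1 (a * r i * p * w), hσ.1 _ w, hσ.2 (σ _), hw]
      noncomm_ring
    rw [this]
    refine G.sum_mem fun i _ => hBG _ _ (mul_mem_Lid _ _) ?_
    rw [mem_Lid hidem, hσ.1, hsv, mul_assoc, neg_mul, hvp]
  have hle : symmElements F A σ ≤ G := by
    intro s hs
    rw [mem_symmElements] at hs
    have := hall s
    rw [hs, ← two_smul F s] at this
    have h2 := G.smul_mem (2:F)⁻¹ this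
    rwa [smul_smul, inv_mul_cancel₀ hF, one_smul] at h2
  have := Submodule.finrank_mono hle
  omega

lemma sym_idem_step (hσ : IsInvolution F A σ) [FiniteDimensional F A] (hF : (2:F) ≠ 0) {p R : A} (hp : Prim p)
    (hp0 : p ≠ 0) (hps : σ p = p) (hR : R * R = R) (hRs : σ R = R) (hR1 : R ≠ 1) :
    ∃ R' : A, R' * R' = R' ∧ σ R' = R' ∧ Module.finrank F (Lid F R') =
      Module.finrank F (Lid F R) + Module.finrank F (Lid F p) := by
  have hidem := hp.idem
  set S := 1 - R with hS
  have hSs : σ S = S := by rw [hS, map_sub, hσ.map_one', hRs]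
  have hRS : R * S = 0 := by rw [hS, mul_sub, hR, mul_one, sub_self]
  have hSS : S * S = S := by rw [hS, sub_mul, one_mul, ← hS, hRS, sub_zero]
  have hS0 : S ≠ 0 := sub_ne_zero.mpr (Ne.symm hR1)
  have hex : ∃ x, S * x = x ∧ x * p = x ∧ σ x * x ≠ 0 := by
    obtain ⟨a, ha⟩ := hp.left hS0
    set x0 := S * a * p with hx0
    have x0p : x0 * p = x0 := by rw [hx0, mul_assoc, hidem]
    have Sx0 : S * x0 = x0 := by rw [hx0, ← mul_assoc, ← mul_assoc, hSS]
    obtain ⟨w, w1, w2, w3⟩ := hp.get_w x0p Sx0 hSS ha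
    set y0 := σ w with hy0
    have y0p : y0 * p = y0 := by rw [hy0]; nth_rewrite 1 [← hps]; rw [← hσ.1, w1]
    have Sy0 : S * y0 = y0 := by rw [hy0]; nth_rewrite 1 [← hSs]; rw [← hσ.1, w2]
    have e1 : σ y0 * x0 = p := by rw [hy0, hσ.2, w3]
    have e2 : σ x0 * y0 = p := by
      have := congrArg σ e1
      rwa [hσ.1, hσ.2, hps] at this
    by_contra hc
    push Not at hc
    have h1 := hc x0 Sx0 x0p
    have h2 := hc y0 Sy0 y0p
    have h3 := hc (x0 + y0) (by rw [mul_add, Sx0, Sy0]) (by rw [add_mul, x0p, y0p])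
    rw [map_add, add_mul, mul_add, mul_add, h1, h2, e1, e2, zero_add, add_zero] at h3
    exact hp0 (two_cancel hF h3)
  obtain ⟨x, Sx, xp, hv⟩ := hex
  obtain ⟨w, h1, h2, h3, h4⟩ := sym_idem_of hσ hp xp hv
  set T := x * w * σ x
  have Rx : R * x = 0 := by rw [← Sx, ← mul_assoc, hRS, zero_mul]
  have RT : R * T = 0 := by
    change R * (x * w * σ x) = 0
    rw [← mul_assoc, ← mul_assoc, Rx]; simp
  have TR : T * R = 0 := by
    have := congrArg σ RT
    rwa [hσ.1, h1, hRs, map_zero] at this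
  refine ⟨R + T, ?_, ?_, ?_⟩
  · simp [mul_add, add_mul, hR, h2, RT, TR]
  · rw [map_add, hRs, h1]
  · rw [Lid_add hR h2 RT TR, h4]

lemma exists_half (hσ : IsInvolution F A σ) [FiniteDimensional F A] (hF : (2:F) ≠ 0) {p : A} (hp : Prim p)
    (hp0 : p ≠ 0) (hps : σ p = p) (k : ℕ) 
    (hk : ∀ m < k, m * Module.finrank F (Lid F p) ≠ Module.finrank F A) :
    ∃ R : A, R * R = R ∧ σ R = R ∧ Module.finrank F (Lid F R) =
      k * Module.finrank F (Lid F p) := by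
  induction k with
  | zero => 
    refine ⟨0, by simp, by simp, ?_⟩
    have : Lid F (0 : A) = ⊥ := by
      rw [Submodule.eq_bot_iff]; rintro _ ⟨y, rfl⟩; simp
    rw [this]; simp
  | succ k ih =>
    obtain ⟨R, h1, h2, h3⟩ := ih (fun m hm => hk m (by omega))
    have : R ≠ 1 := by
      rintro rfl
      rw [Lid_one, finrank_top] at h3
      exact hk k (by omega) h3.symm
    obtain ⟨R', h4, h5, h6⟩ := sym_idem_step hσ hF hp hp0 hps h1 h2 this
    exact ⟨R', h4, h5, by rw [h6, h3]; ring⟩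

end SymPrim

section Cliff

variable {F A : Type} [Field F] [Ring A] [Algebra F A]

/-- The existence of the generators `e, g` of a stable copy of `Ad`. -/
def HasEG (F : Type) {A : Type} [Field F] [Ring A] [Algebra F A] (σ : A →ₗ[F] A) : Prop :=
  ∃ (e g : A) (lam : F), lam ≠ 0 ∧ σ e = e ∧ e * e = 1 ∧ σ g = -g ∧ g * g = lam • 1 ∧
    e * g = - (g * e)

/-- Seven anticommuting skew elements. -/
structure Seven (σ : A →ₗ[F] A) (f : Fin 7 → A) (q : Fin 7 → F) : Prop where
  ne : ∀ i, q i ≠ 0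
  skew : ∀ i, σ (f i) = - f i
  sq : ∀ i, f i * f i = q i • 1
  anti : ∀ i j, i ≠ j → f i * f j = - (f j * f i)

/-- linear combination map -/
def comb (f : Fin 7 → A) : (Fin 7 → F) →ₗ[F] A := Fintype.linearCombination F f

lemma comb_apply (f : Fin 7 → A) (c : Fin 7 → F) : comb f c = ∑ i, c i • f i := by
  simp [comb, Fintype.linearCombination_apply]

variable {σ : A →ₗ[F] A} {f : Fin 7 → A} {q : Fin 7 → F}

lemma Seven.polar (h : Seven σ f q) (c d : Fin 7 → F) :
    comb f c * comb f d + comb f d * comb f c = (2 * ∑ i, c i * d i * q i) • 1 := by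
  have key : ∀ i j, f i * f j + f j * f i = if i = j then (2 * q i) • (1 : A) else 0 := by
    intro i j
    split_ifs with hij
    · subst hij; rw [h.sq, ← add_smul, two_mul]
    · rw [h.anti i j hij]; simp
  have : comb f c * comb f d + comb f d * comb f c =
      ∑ i, ∑ j, (c i * d j) • (f i * f j + f j * f i) := by
    rw [comb_apply, comb_apply, Finset.sum_mul_sum, Finset.sum_mul_sum]
    rw [Finset.sum_comm (s := Finset.univ) (t := Finset.univ) (f := fun i j => d i • f i * c j • f j)]
    simp only [← Finset.sum_add_distrib]
    refine Finset.sum_congr rfl fun i _ => Finset.sum_congr rfl fun j _ => ?_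
    simp only [smul_mul_smul_comm, smul_add]
    rw [mul_comm (d j)]
  rw [this]
  simp only [key, smul_ite, smul_zero, Finset.sum_ite_eq, Finset.mem_univ, if_true]
  rw [Finset.mul_sum, Finset.sum_smul]
  refine Finset.sum_congr rfl fun i _ => ?_
  rw [smul_smul]; congr 1; ring

lemma Seven.comb_sq (hF : (2:F) ≠ 0) (h : Seven σ f q) (c : Fin 7 → F) :
    comb f c * comb f c = (∑ i, c i * c i * q i) • 1 := by
  have := h.polar c c
  rw [mul_smul, ← two_smul F (comb f c * comb f c)] at this
  have h2 := congrArg (fun x => (2:F)⁻¹ • x) this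
  simpa only [smul_smul, inv_mul_cancel₀ hF, inv_mul_cancel_left₀ hF, one_smul] using h2

lemma Seven.comb_skew (h : Seven σ f q) (c : Fin 7 → F) : σ (comb f c) = - comb f c := by
  rw [comb_apply, map_sum, ← Finset.sum_neg_distrib]
  refine Finset.sum_congr rfl fun i _ => ?_
  rw [map_smul, h.skew, smul_neg]

/-- Sandwich map. -/
def sand (F : Type) {A : Type} [Field F] [Ring A] [Algebra F A] (P R : A) : A →ₗ[F] A :=
  LinearMap.mulLeft F P ∘ₗ LinearMap.mulRight F R

lemma sand_apply (P R x : A) : sand F P R x = P * x * R := by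
  simp [sand, mul_assoc]

/-- skew part of the corner -/
def skc (σ : A →ₗ[F] A) (P : A) : Submodule F A := (skewElements F A σ).map (sand F P P)

lemma eg_of_small [FiniteDimensional F A] (hF : (2:F) ≠ 0)
    (h : Seven σ f q) (haniso : ∀ c : Fin 7 → F, c ≠ 0 → ∑ i, c i * c i * q i ≠ 0)
    {P : A} (hσ : IsInvolution F A σ) (hP : P * P = P) (hPs : σ P = P)
    (hdim : Module.finrank F (Lid F P) = Module.finrank F (Lid F (1 - P)))
    (hk : Module.finrank F (skc σ P) ≤ 6) : HasEG F σ := by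
  let T : (Fin 7 → F) →ₗ[F] A := sand F P P ∘ₗ comb f
  have hT : LinearMap.range T ≤ skc σ P := by
    rintro _ ⟨c, rfl⟩
    exact ⟨comb f c, mem_skewElements.mpr (h.comb_skew c), rfl⟩
  have hrn := LinearMap.finrank_range_add_finrank_ker T
  have h7 : Module.finrank F (Fin 7 → F) = 7 := by simp
  have hr := Submodule.finrank_mono hT
  have hker : LinearMap.ker T ≠ ⊥ := by
    intro hb
    rw [hb, finrank_bot] at hrn
    omega
  obtain ⟨c, hc, hc0⟩ := Submodule.exists_mem_ne_zero_of_ne_bot hker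
  set g := comb f c with hg
  set k := ∑ i, c i * c i * q i with hkdef
  have hk0 : k ≠ 0 := haniso c hc0
  have hgg : g * g = k • 1 := h.comb_sq hF c
  have hPgP : P * g * P = 0 := by
    have : T c = 0 := hc
    rwa [LinearMap.comp_apply, sand_apply] at this
  set S := 1 - P with hS
  have hPS : P * S = 0 := by rw [hS, mul_sub, hP, mul_one, sub_self]
  have hSS : S * S = S := by rw [hS, sub_mul, one_mul, ← hS, hPS, sub_zero]
  let L : Lid F P →ₗ[F] Lid F S :=
    LinearMap.codRestrict _ ((LinearMap.mulRight F g).domRestrict (Lid F P)) (by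
      rintro ⟨a, ha⟩
      rw [mem_Lid hP] at ha
      rw [mem_Lid hSS]
      change a * g * S = a * g
      rw [← ha, hS, mul_sub, mul_one]
      have : a * P * g * P = a * (P * g * P) := by simp only [mul_assoc]
      rw [this, hPgP, mul_zero, sub_zero])
  have hLinj : Function.Injective L := by
    rintro ⟨a, ha⟩ ⟨b, hb⟩ hab
    have h1 : a * g = b * g := congrArg Subtype.val hab
    have h2 : (a - b) * g = 0 := by rw [sub_mul, h1, sub_self]
    ext
    exact sub_eq_zero.mp (unit_of_sq hk0 hgg h2)
  have hLsurj := (LinearMap.injective_iff_surjective_of_finrank_eq_finrank hdim).mp hLinj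
  obtain ⟨⟨a, ha⟩, hab⟩ := hLsurj ⟨S, (mem_Lid hSS).mpr hSS⟩
  have haS : a * g = S := congrArg Subtype.val hab
  rw [mem_Lid hP] at ha
  have hSgS : S * g * S = 0 := by
    rw [← haS, mul_assoc a g g, hgg, mul_smul_comm, mul_one, haS, smul_mul_assoc, ← ha, mul_assoc,
      hPS, mul_zero, smul_zero]
  have hPg : P * g = g - g * P := by
    have : S * g * S = g - P * g - g * P + P * g * P := by rw [hS]; noncomm_ring
    rw [hPgP, hSgS, add_zero] at this
    rw [eq_comm, sub_eq_zero] at this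
    rw [← sub_eq_zero]
    rw [← sub_eq_zero] at this
    rw [← neg_eq_zero, ← this]; abel
  refine ⟨P + P - 1, g, k, hk0, ?_, ?_, h.comb_skew c, hgg, ?_⟩
  · rw [map_sub, map_add, hPs, hσ.map_one']
  · simp only [mul_sub, sub_mul, mul_add, add_mul, hP, mul_one, one_mul]; abel
  · simp only [mul_sub, sub_mul, mul_add, add_mul, hPg, mul_one, one_mul]; abel

lemma eg_of_aniso [FiniteDimensional F A] [IsSimpleRing A] (hF : (2:F) ≠ 0)
    (h64 : Module.finrank F A = 64) (h28 : Module.finrank F (skewElements F A σ) = 28)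
    (h : Seven σ f q) (haniso : ∀ c : Fin 7 → F, c ≠ 0 → ∑ i, c i * c i * q i ≠ 0)
    {P : A} (hσ : IsInvolution F A σ) (hP : P * P = P) (hPs : σ P = P)
    (hdim : Module.finrank F (Lid F P) = 32) : HasEG F σ := by
  set S := 1 - P with hS
  have hPS : P * S = 0 := by rw [hS, mul_sub, hP, mul_one, sub_self]
  have hSP : S * P = 0 := by rw [hS, sub_mul, hP, one_mul, sub_self]
  have hSS : S * S = S := by rw [hS, sub_mul, one_mul, ← hS, hPS, sub_zero]
  have hSs : σ S = S := by rw [hS, map_sub, hσ.map_one', hPs]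
  have hdimS : Module.finrank F (Lid F S) = 32 := by
    have h1 := Lid_add (F := F) hP hSS hPS hSP
    have : P + S = 1 := by rw [hS]; abel
    rw [this, Lid_one, finrank_top] at h1
    omega
  obtain ⟨x, y, hPx, hxS, hSy, hyP, hxy, hyx⟩ := idem_iso (F := F) hP hSS (by rw [hdim, hdimS])
  let X := LinearMap.range (sand F P S)
  let Y := LinearMap.range (sand F S S)
  have hXm : ∀ {z}, z ∈ X → P * z = z ∧ z * S = z := by
    rintro _ ⟨a, rfl⟩
    simp only [sand_apply]
    constructor
    · rw [← mul_assoc, ← mul_assoc, hP]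
    · rw [mul_assoc, hSS]
  have hYm : ∀ {z}, z ∈ Y → S * z = z ∧ z * S = z := by
    rintro _ ⟨a, rfl⟩
    simp only [sand_apply]
    constructor
    · rw [← mul_assoc, ← mul_assoc, hSS]
    · rw [mul_assoc, hSS]
  have hX16 : 16 ≤ Module.finrank F X := by
    have hsup : Lid F S ≤ X ⊔ Y := by
      rintro _ ⟨a, rfl⟩
      have : LinearMap.mulRight F S a = sand F P S a + sand F S S a := by
        simp only [sand_apply, LinearMap.mulRight_apply, hS]; noncomm_ring
      rw [this]
      exact Submodule.add_mem_sup ⟨a, rfl⟩ ⟨a, rfl⟩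
    have h1 := Submodule.finrank_mono hsup
    have h2 := Submodule.finrank_add_le_finrank_add_finrank X Y
    have h3 : Module.finrank F Y ≤ Module.finrank F X := by
      let L : Y →ₗ[F] X :=
        LinearMap.codRestrict _ ((LinearMap.mulLeft F x).domRestrict Y) (by
          rintro ⟨z, hz⟩
          refine ⟨x * z, ?_⟩
          change sand F P S (x * z) = x * z
          rw [sand_apply, ← mul_assoc, hPx, mul_assoc, (hYm hz).2])
      refine LinearMap.finrank_le_finrank_of_injective (f := L) ?_
      rintro ⟨a, ha⟩ ⟨b, hb⟩ hab
      have h1 : x * a = x * b := congrArg Subtype.val hab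
      ext
      change a = b
      rw [← (hYm ha).1, ← (hYm hb).1, ← hyx, mul_assoc, mul_assoc, h1]
    omega
  let K := skewElements F A σ
  let Ψ : K →ₗ[F] A × A := ((sand F P P).prod (sand F S S)).domRestrict K
  have hrn := LinearMap.finrank_range_add_finrank_ker Ψ
  have hker : Module.finrank F X ≤ Module.finrank F (LinearMap.ker Ψ) := by
    have hσX : ∀ {z}, z ∈ X → S * σ z = σ z ∧ σ z * P = σ z := by
      intro z hz
      obtain ⟨h1, h2⟩ := hXm hz
      constructor
      · nth_rewrite 1 [← hSs]; rw [← hσ.1, h2]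
      · nth_rewrite 1 [← hPs]; rw [← hσ.1, h1]
    have hPz : ∀ {z}, z ∈ X → P * σ z = 0 ∧ σ z * S = 0 ∧ z * P = 0 ∧ S * z = 0 := by
      intro z hz
      obtain ⟨h1, h2⟩ := hXm hz
      obtain ⟨h3, h4⟩ := hσX hz
      refine ⟨?_, ?_, ?_, ?_⟩
      · rw [← h3, ← mul_assoc, hPS, zero_mul]
      · rw [← h4, mul_assoc, hPS, mul_zero]
      · rw [← h2, mul_assoc, hSP, mul_zero]
      · rw [← h1, ← mul_assoc, hSP, zero_mul]
    let L0 : X →ₗ[F] K := LinearMap.codRestrict _ ((LinearMap.id - σ).domRestrict X) (by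
      rintro ⟨z, hz⟩
      rw [mem_skewElements]
      change σ (z - σ z) = - (z - σ z)
      rw [map_sub, hσ.2, neg_sub])
    let L : X →ₗ[F] LinearMap.ker Ψ := LinearMap.codRestrict _ L0 (by
      rintro ⟨z, hz⟩
      obtain ⟨h1, h2⟩ := hXm hz
      obtain ⟨h3, h4, h5, h6⟩ := hPz hz
      rw [LinearMap.mem_ker]
      change (sand F P P (z - σ z), sand F S S (z - σ z)) = 0
      simp only [sand_apply, mul_sub, sub_mul, h1, h3, h5, h6, h4, mul_assoc]
      simp)
    refine LinearMap.finrank_le_finrank_of_injective (f := L) ?_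
    rw [injective_iff_map_eq_zero]
    rintro ⟨z, hz⟩ hab
    have h0 : z - σ z = 0 := congrArg (fun t : LinearMap.ker Ψ => ((t : K) : A)) hab
    obtain ⟨h1, h2⟩ := hXm hz
    obtain ⟨h3, h4, h5, h6⟩ := hPz hz
    ext
    change z = 0
    rw [← h1, sub_eq_zero.mp h0, h3]
  have hprod : (skc σ P).prod (skc σ S) ≤ LinearMap.range Ψ := by
    rintro ⟨u, v⟩ ⟨⟨s, hs, hs'⟩, ⟨t, ht, ht'⟩⟩
    simp only [SetLike.mem_coe, mem_skewElements] at hs ht hs' ht'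
    rw [sand_apply] at hs' ht'
    refine ⟨⟨P * s * P + S * t * S, ?_⟩, ?_⟩
    · rw [mem_skewElements, map_add, hσ.1, hσ.1, hσ.1, hσ.1, hPs, hSs, hs, ht]
      noncomm_ring
    · change (sand F P P (P * s * P + S * t * S), sand F S S (P * s * P + S * t * S)) = (u, v)
      rw [sand_apply, sand_apply, ← hs', ← ht']
      have e1 : P * (P * s * P + S * t * S) * P = P * s * P := by
        have : P * (P * s * P + S * t * S) * P = (P * P) * s * (P * P) + (P * S) * t * S * P := by
          noncomm_ring
        rw [this, hP, hPS]; simp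
      have e2 : S * (P * s * P + S * t * S) * S = S * t * S := by
        have : S * (P * s * P + S * t * S) * S = (S * S) * t * (S * S) + (S * P) * s * P * S := by
          noncomm_ring
        rw [this, hSS, hSP]; simp
      rw [e1, e2]
  have h12 := Submodule.finrank_mono hprod
  have hpr : Module.finrank F ((skc σ P).prod (skc σ S)) =
      Module.finrank F (skc σ P) + Module.finrank F (skc σ S) := by
    rw [← Module.finrank_prod]
    exact LinearEquiv.finrank_eq
      { toFun := fun z => (⟨z.1.1, z.2.1⟩, ⟨z.1.2, z.2.2⟩)
        invFun := fun z => ⟨(z.1.1, z.2.1), ⟨z.1.2, z.2.2⟩⟩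
        map_add' := fun _ _ => rfl
        map_smul' := fun _ _ => rfl
        left_inv := fun _ => rfl
        right_inv := fun _ => rfl }
  have hK : Module.finrank F K = 28 := h28
  by_cases hk : Module.finrank F (skc σ P) ≤ 6
  · exact eg_of_small hF h haniso hσ hP hPs (by rw [hdim, ← hS, hdimS]) hk
  · refine eg_of_small hF h haniso hσ hSS hSs ?_ (by omega)
    have : 1 - S = P := by rw [hS]; abel
    rw [this, hdim, hdimS]

end Cliff

section Iso

variable {F A : Type} [Field F] [Ring A] [Algebra F A]

lemma eg_of_four (hF : (2:F) ≠ 0) {σ : A →ₗ[F] A} (hσ : IsInvolution F A σ) {f h u v : A}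
    {q α β : F} (hq : q ≠ 0) (hα : α ≠ 0) (hβ : β ≠ 0)
    (ff : f * f = q • 1) (hh : h * h = (-q) • 1) (uu : u * u = α • 1) (vv : v * v = β • 1)
    (sf : σ f = -f) (sh : σ h = -h) (su : σ u = -u) (sv : σ v = -v)
    (hf : h * f = -(f * h)) (uf : u * f = -(f * u)) (vf : v * f = -(f * v))
    (uh : u * h = -(h * u)) (vh : v * h = -(h * v)) (vu : v * u = -(u * v)) : HasEG F σ := by
  let t : F := -(q * α * β)⁻¹
  let x : F := (t + 1) / 2
  let y : F := (t - 1) / 2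
  have hxy : (x * x - y * y) * q * (α * β) = -1 := by
    have : x * x - y * y = t := by simp only [x, y]; field_simp; ring
    rw [this]; simp only [t]; field_simp
  obtain ⟨p, hp⟩ : ∃ p, p = x • f + y • h := ⟨_, rfl⟩
  have up : u * p = -(p * u) := by
    rw [hp, mul_add, add_mul, mul_smul_comm, mul_smul_comm, uf, uh, smul_mul_assoc, smul_mul_assoc]
    module
  have vp : v * p = -(p * v) := by
    rw [hp, mul_add, add_mul, mul_smul_comm, mul_smul_comm, vf, vh, smul_mul_assoc, smul_mul_assoc]
    module
  have pp : p * p = ((x * x - y * y) * q) • 1 := by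
    rw [hp, add_mul, mul_add, mul_add]
    simp only [smul_mul_smul_comm, ff, hh, hf]
    module
  have sp : σ p = - p := by
    rw [hp, map_add, map_smul, map_smul, sf, sh]; module
  have anti : ∀ {x y : A} (h : y * x = -(x * y)) (z), y * (x * z) = -(x * (y * z)) :=
    fun h z => assoc_anti h z
  have hgp : (f * h) * p = -(p * (f * h)) := by
    rw [hp, mul_add, add_mul]
    simp only [smul_mul_assoc, mul_smul_comm, mul_assoc, hf, hh, assoc_sq ff, assoc_anti hf]
    simp only [mul_neg, mul_smul_comm, mul_one, ff, neg_smul, smul_neg, ← mul_assoc, ff]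
    simp only [mul_smul_comm, mul_one, smul_mul_assoc, one_mul]
    module
  refine ⟨p * u * v, q⁻¹ • (f * h), 1, one_ne_zero, ?_, ?_, ?_, ?_, ?_⟩
  · rw [hσ.1, hσ.1, sp, su, sv]
    simp only [neg_mul, mul_neg, neg_neg, mul_assoc, up, vu, vp, anti up, anti vp]
  · have : p * u * v * (p * u * v) = -((p * p) * (u * u) * (v * v)) := by
      simp only [mul_assoc, anti vp, anti up, anti vu, mul_neg, neg_neg]
    rw [this, pp, uu, vv]
    simp only [smul_mul_smul_comm, mul_one]
    rw [← neg_smul]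
    rw [show -((x * x - y * y) * q * α * β) = 1 by linear_combination -hxy]
    simp
  · rw [map_smul, hσ.1, sf, sh, neg_mul_neg, hf]; module
  · rw [smul_mul_smul_comm]
    have : f * h * (f * h) = -((f * f) * (h * h)) := by
      simp only [mul_assoc, anti hf, mul_neg]
    rw [this, ff, hh, smul_mul_smul_comm, ← smul_neg, mul_one]
    rw [show (-(1:A)) = (-1:F) • 1 by simp, smul_smul, smul_smul]
    congr 1; field_simp
  · rw [mul_smul_comm, smul_mul_assoc, ← smul_neg]
    congr 1
    have e1 : f * h * (p * u * v) = (f * h * p) * (u * v) := by simp only [mul_assoc]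
    have e2 : p * u * v * (f * h) = p * (f * h) * (u * v) := by
      simp only [mul_assoc, anti vf, anti uf, vh, uh, anti vh, anti uh, mul_neg, neg_neg]
    rw [e1, e2, hgp]; simp

/-- the bilinear form -/
def bq (q c d : Fin 7 → F) : F := ∑ i, c i * d i * q i

lemma bq_comm (q c d : Fin 7 → F) : bq q c d = bq q d c := by
  unfold bq; exact Finset.sum_congr rfl fun i _ => by ring
lemma bq_add (q c d e : Fin 7 → F) : bq q (c + d) e = bq q c e + bq q d e := by
  unfold bq; rw [← Finset.sum_add_distrib]
  exact Finset.sum_congr rfl fun i _ => by simp; ring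
lemma bq_smul (q c e : Fin 7 → F) (t : F) : bq q (t • c) e = t * bq q c e := by
  unfold bq; rw [Finset.mul_sum]
  exact Finset.sum_congr rfl fun i _ => by simp; ring
lemma bq_sub (q c d e : Fin 7 → F) : bq q (c - d) e = bq q c e - bq q d e := by
  unfold bq; rw [← Finset.sum_sub_distrib]
  exact Finset.sum_congr rfl fun i _ => by simp; ring
lemma bq_sum {k : ℕ} (q e : Fin 7 → F) (v : Fin k → Fin 7 → F) :
    bq q (∑ j, v j) e = ∑ j, bq q (v j) e := by
  unfold bq; rw [Finset.sum_comm]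
  exact Finset.sum_congr rfl fun i _ => by
    rw [Finset.sum_apply, Finset.sum_mul, Finset.sum_mul]

lemma exists_aniso (hF : (2:F) ≠ 0) {q : Fin 7 → F} (hq : ∀ i, q i ≠ 0) {k : ℕ} (hk : k < 7)
    (v : Fin k → Fin 7 → F) (hv : ∀ i, bq q (v i) (v i) ≠ 0)
    (hvv : ∀ i j, i ≠ j → bq q (v i) (v j) = 0) :
    ∃ w, bq q w w ≠ 0 ∧ ∀ i, bq q w (v i) = 0 := by
  by_contra hcon
  push Not at hcon
  have hcon' : ∀ w, (∀ i, bq q w (v i) = 0) → bq q w w = 0 := by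
    intro w hw; by_contra h
    obtain ⟨i, hi⟩ := hcon w h; exact hi (hw i)
  let pr : (Fin 7 → F) → (Fin 7 → F) := fun x =>
    x - ∑ i, (bq q x (v i) / bq q (v i) (v i)) • v i
  have hpr : ∀ x i, bq q (pr x) (v i) = 0 := by
    intro x i
    simp only [pr, bq_sub, bq_sum, bq_smul]
    rw [Finset.sum_eq_single i]
    · field_simp [hv i]; ring
    · intro j _ hj; rw [hvv j i hj, mul_zero]
    · simp
  have hzero : ∀ x y, bq q (pr x) (pr y) = 0 := by
    intro x y
    have h := hcon' (pr x + pr y) (fun i => by rw [bq_add, hpr, hpr, add_zero])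
    rw [bq_add, bq_comm q (pr x), bq_comm q (pr y) (pr x + pr y), bq_add, bq_add,
      hcon' _ (hpr x), hcon' _ (hpr y), bq_comm q (pr y) (pr x)] at h
    have : 2 * bq q (pr x) (pr y) = 0 := by linear_combination h
    exact (mul_eq_zero.mp this).resolve_left hF
  have hzero' : ∀ x y, bq q (pr x) y = 0 := by
    intro x y
    have h := hzero x y
    rw [bq_comm] at h
    simp only [pr, bq_sub, bq_sum, bq_smul] at h
    rw [bq_comm]
    have h2 : ∀ i, bq q (v i) (pr x) = 0 := fun i => by rw [bq_comm, hpr]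
    have h3 := h
    change bq q y (pr x) - ∑ i, bq q y (v i) / bq q (v i) (v i) * bq q (v i) (pr x) = 0 at h3
    simpa [h2] using h3
  have hpz : ∀ x, pr x = 0 := by
    intro x; ext i
    have := hzero' x (Pi.single i 1)
    unfold bq at this
    rw [Finset.sum_eq_single i (by intro j _ hj; simp [hj]) (by simp)] at this
    simpa [hq i] using this
  have hspan : Submodule.span F (Set.range v) = ⊤ := by
    rw [eq_top_iff]; rintro x -
    have := hpz x
    simp only [pr, sub_eq_zero] at this
    rw [this]
    exact Submodule.sum_mem _ fun i _ => Submodule.smul_mem _ _ (Submodule.subset_span ⟨i, rfl⟩)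
  have h1 := finrank_range_le_card (R := F) v
  rw [Set.finrank, hspan, finrank_top] at h1
  simp at h1
  omega

lemma eg_of_iso (hF : (2:F) ≠ 0) {σ : A →ₗ[F] A} (hσ : IsInvolution F A σ)
    {f : Fin 7 → A} {q : Fin 7 → F} (h : Seven σ f q) {c : Fin 7 → F} (hc : c ≠ 0)
    (hQ : ∑ i, c i * c i * q i = 0) : HasEG F σ := by
  obtain ⟨i0, hi0⟩ := Function.ne_iff.mp hc
  simp only [Pi.zero_apply] at hi0
  have hQ' : bq q c c = 0 := hQ
  have hsing : ∀ d, bq q d (Pi.single i0 1) = d i0 * q i0 := by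
    intro d; unfold bq
    rw [Finset.sum_eq_single i0 (by intro j _ hj; simp [hj]) (by simp)]; simp
  let s : Fin 7 → F := Pi.single i0 1
  let d : Fin 7 → F := (c i0)⁻¹ • c - s
  have hss : bq q s s = q i0 := by rw [hsing]; simp [s]
  have hcs : bq q c s = c i0 * q i0 := hsing c
  have hds : bq q d s = 0 := by
    simp only [d, bq_sub, bq_smul, hcs, hss]; field_simp; ring
  have hdc : bq q d c = - (c i0 * q i0) := by
    simp only [d, bq_sub, bq_smul, hQ', bq_comm q s c, hcs]; ring
  have hdd : bq q d d = - q i0 := by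
    have : bq q d d = (c i0)⁻¹ * bq q c d - bq q s d := by
      conv_lhs => rw [show d = (c i0)⁻¹ • c - s from rfl, bq_sub, bq_smul]
    rw [this, bq_comm q c, bq_comm q s, hds, hdc]; field_simp; ring
  have hq := h.ne i0
  obtain ⟨u, hu, hu'⟩ := exists_aniso hF h.ne (k := 2) (by norm_num) ![s, d]
    (by intro i; fin_cases i <;> simp [hss, hdd, hq])
    (by intro i j hij; fin_cases i <;> fin_cases j <;> simp [hds, bq_comm q s d] at hij ⊢)
  have hus : bq q u s = 0 := by simpa using hu' 0
  have hud : bq q u d = 0 := by simpa using hu' 1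
  obtain ⟨v, hv, hv'⟩ := exists_aniso hF h.ne (k := 3) (by norm_num) ![s, d, u]
    (by intro i; fin_cases i <;> simp [hss, hdd, hq, hu])
    (by intro i j hij; fin_cases i <;> fin_cases j <;>
          simp [hds, hus, hud, bq_comm q s d, bq_comm q s u, bq_comm q d u] at hij ⊢)
  have hvs : bq q v s = 0 := by simpa using hv' 0
  have hvd : bq q v d = 0 := by simpa using hv' 1
  have hvu : bq q v u = 0 := by simpa using hv' 2
  have anti : ∀ x y, bq q x y = 0 → comb f x * comb f y = - (comb f y * comb f x) := by
    intro x y hxy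
    have := h.polar x y
    rw [show ∑ i, x i * y i * q i = 0 from hxy] at this
    simpa using eq_neg_of_add_eq_zero_left (by simpa using this)
  have sq : ∀ x, comb f x * comb f x = bq q x x • 1 := fun x => h.comb_sq hF x
  exact eg_of_four hF hσ (f := comb f s) (h := comb f d) (u := comb f u) (v := comb f v)
    hq hu hv (by rw [sq, hss]) (by rw [sq, hdd]) (sq u) (sq v)
    (h.comb_skew s) (h.comb_skew d) (h.comb_skew u) (h.comb_skew v)
    (anti _ _ hds) (anti _ _ hus) (anti _ _ hvs) (anti _ _ hud) (anti _ _ hvd) (anti _ _ hvu)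

end Iso

section SymTensor

variable {F : Type} [Field F]

lemma sym_card {A ι : Type} [Ring A] [Algebra F A] [Fintype ι] (hF : (2:F) ≠ 0)
    (b : Module.Basis ι F A) (ε : ι → Prop) [DecidablePred ε] (θ : A →ₗ[F] A)
    (hb : ∀ i, θ (b i) = if ε i then b i else - b i) :
    Module.finrank F (symmElements F A θ) = Fintype.card {i // ε i} := by
  have hspan : symmElements F A θ = Submodule.span F (Set.range fun i : {i // ε i} => b i) := by
    apply le_antisymm
    · intro x hx
      rw [mem_symmElements] at hx
      have hz : ∀ i, ¬ ε i → b.repr x i = 0 := by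
        intro i hi
        have h1 : b.coord i ∘ₗ θ = (-1 : F) • b.coord i := by
          apply b.ext
          intro j
          by_cases hij : j = i
          · subst hij; simp [hb, hi]
          · simp [hb, hij, Finsupp.single_apply]
            split_ifs <;> simp [hij, Finsupp.single_apply]
        have h2 := congrArg (fun l => l x) h1
        simp [hx] at h2
        have h3 : (2:F) * b.repr x i = 0 := by linear_combination h2
        exact (mul_eq_zero.mp h3).resolve_left hF
      rw [← b.sum_repr x]
      refine Submodule.sum_mem _ fun i _ => ?_
      by_cases hi : ε i
      · exact Submodule.smul_mem _ _ (Submodule.subset_span ⟨⟨i, hi⟩, rfl⟩)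
      · rw [hz i hi]; simp
    · rw [Submodule.span_le]
      rintro _ ⟨⟨i, hi⟩, rfl⟩
      simp [mem_symmElements, hb, hi]
  rw [hspan]
  exact finrank_span_eq_card (b.linearIndependent.comp _ Subtype.val_injective)

lemma exists_eigenbasis {A : Type} [Ring A] [Algebra F A] [FiniteDimensional F A]
    (hF : (2:F) ≠ 0) (θ : A →ₗ[F] A) (h : ∀ x, θ (θ x) = x) :
    ∃ b : Module.Basis (Fin (Module.finrank F (symmElements F A θ)) ⊕
        Fin (Module.finrank F (skewElements F A θ))) F A,
      ∀ i, θ (b i) = if i.isLeft then b i else - b i := by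
  let b0 := (Module.finBasis F (symmElements F A θ)).prod (Module.finBasis F (skewElements F A θ))
  refine ⟨b0.map (Submodule.prodEquivOfIsCompl _ _ (sym_skew_isCompl hF θ h)), ?_⟩
  rintro (i | i)
  · simp [b0]
    exact mem_symmElements.mp (Subtype.mem _)
  · simp [b0]
    exact mem_skewElements.mp (Subtype.mem _)

lemma sym_tensor {A B : Type} [Ring A] [Algebra F A] [FiniteDimensional F A]
    [Ring B] [Algebra F B] [FiniteDimensional F B] (hF : (2:F) ≠ 0)
    (θ : A →ₗ[F] A) (h : ∀ x, θ (θ x) = x) (η : B →ₗ[F] B) (h' : ∀ x, η (η x) = x) :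
    Module.finrank F (symmElements F (A ⊗[F] B) (TensorProduct.map θ η)) =
      Module.finrank F (symmElements F A θ) * Module.finrank F (symmElements F B η) +
      Module.finrank F (skewElements F A θ) * Module.finrank F (skewElements F B η) := by
  obtain ⟨b, hb⟩ := exists_eigenbasis hF θ h
  obtain ⟨c, hc⟩ := exists_eigenbasis hF η h'
  have := sym_card hF (b.tensorProduct c) (fun p => p.1.isLeft = p.2.isLeft) (TensorProduct.map θ η)
    (by
      rintro ⟨i, j⟩
      simp only [Module.Basis.tensorProduct_apply, TensorProduct.map_tmul, hb, hc]
      cases i <;> cases j <;> simp [TensorProduct.neg_tmul, TensorProduct.tmul_neg])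
  rw [this]
  rw [Fintype.card_subtype, Finset.card_filter, Fintype.sum_prod_type]
  simp [Fintype.sum_sum_type, -Finset.sum_boole]

end SymTensor

section Conj

variable {F : Type} [Field F]

/-- `diag(1,-1)` -/
def mE (F : Type) [Field F] : Matrix (Fin 2) (Fin 2) F := !![1, 0; 0, -1]
/-- the generator with square `l` -/
def mG {F : Type} [Field F] (l : F) : Matrix (Fin 2) (Fin 2) F := !![0, l; 1, 0]

lemma adjInvo_apply (c : F) (hc : c ≠ 0) (X : Matrix (Fin 2) (Fin 2) F) :
    adjInvo F c X = !![X 0 0, c * X 1 0; c⁻¹ * X 0 1, X 1 1] := by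
  have hi : (Matrix.diagonal ![1, c])⁻¹ = Matrix.diagonal ![1, c⁻¹] := by
    apply Matrix.inv_eq_right_inv
    rw [Matrix.diagonal_mul_diagonal, ← Matrix.diagonal_one]
    congr 1; ext i; fin_cases i <;> simp [hc]
  change (Matrix.diagonal ![1, c])⁻¹ * Xᵀ * Matrix.diagonal ![1, c] = _
  rw [hi]
  ext i j
  fin_cases i <;> fin_cases j <;> simp [Matrix.mul_diagonal, Matrix.diagonal_mul, mul_comm]
  field_simp

lemma adj_invol (c : F) (hc : c ≠ 0) (X) : adjInvo F c (adjInvo F c X) = X := by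
  rw [adjInvo_apply c hc, adjInvo_apply c hc]
  ext i j
  fin_cases i <;> fin_cases j <;> simp [hc]

lemma adj_dims (hF : (2:F) ≠ 0) (l : F) (hl : l ≠ 0) :
    Module.finrank F (symmElements F _ (adjInvo F (-l))) = 3 ∧
    Module.finrank F (skewElements F _ (adjInvo F (-l))) = 1 := by
  have hl' : -l ≠ 0 := neg_ne_zero.mpr hl
  have h1 : skewElements F _ (adjInvo F (-l)) = Submodule.span F {mG l} := by
    ext X
    rw [mem_skewElements, adjInvo_apply _ hl', Submodule.mem_span_singleton]
    constructor
    · intro h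
      have h00 := congrFun (congrFun h 0) 0
      have h01 := congrFun (congrFun h 0) 1
      have h11 := congrFun (congrFun h 1) 1
      simp at h00 h01 h11
      have z : ∀ t : F, t = -t → t = 0 := fun t ht => by
        have : 2 * t = 0 := by linear_combination ht
        exact (mul_eq_zero.mp this).resolve_left hF
      refine ⟨X 1 0, ?_⟩
      ext i j
      fin_cases i <;> fin_cases j <;> simp [mG, z _ h00, z _ h11]
      rw [← h01]; ring
    · rintro ⟨a, rfl⟩
      ext i j
      fin_cases i <;> fin_cases j <;> simp [mG]
      · ring
      · field_simp
  have h2 : Module.finrank F (skewElements F _ (adjInvo F (-l))) = 1 := by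
    rw [h1]; apply finrank_span_singleton
    intro h
    have := congrFun (congrFun h 1) 0
    simp [mG] at this
  have h3 := finrank_sym_skew hF (adjInvo F (-l)) (adj_invol _ hl')
  rw [h2, Module.finrank_matrix] at h3
  simp at h3
  omega

lemma mat_decomp (X : Matrix (Fin 2) (Fin 2) F) (hF : (2:F) ≠ 0) {l : F} (hl : l ≠ 0) :
    ∃ a b c d : F, X = a • 1 + b • mE F + c • mG l + d • (mE F * mG l) := by
  refine ⟨(X 0 0 + X 1 1) / 2, (X 0 0 - X 1 1) / 2, (X 1 0 + X 0 1 / l) / 2,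
    (X 0 1 / l - X 1 0) / 2, ?_⟩
  ext i j
  fin_cases i <;> fin_cases j <;> simp [mE, mG, Matrix.mul_apply] <;> field_simp <;> ring

lemma exists_theta {D : Type} [Ring D] [Algebra F D] [FiniteDimensional F D] (hF : (2:F) ≠ 0)
    {l : F} (hl : l ≠ 0)
    (τ : D ⊗[F] Matrix (Fin 2) (Fin 2) F →ₗ[F] D ⊗[F] Matrix (Fin 2) (Fin 2) F)
    (hτ : IsInvolution F _ τ) (hE : τ (1 ⊗ₜ mE F) = 1 ⊗ₜ mE F)
    (hG : τ (1 ⊗ₜ mG l) = - (1 ⊗ₜ mG l)) :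
    ∃ θ : D →ₗ[F] D, IsInvolution F D θ ∧ τ = TensorProduct.map θ (adjInvo F (-l)) := by
  let m := matrixEquivTensor (Fin 2) F D
  let ev : Matrix (Fin 2) (Fin 2) D →ₗ[F] D :=
    { toFun := fun X => X 0 0, map_add' := fun _ _ => rfl, map_smul' := fun _ _ => rfl }
  let θ : D →ₗ[F] D := ev ∘ₗ m.symm.toLinearMap ∘ₗ τ ∘ₗ
    (TensorProduct.mk F D (Matrix (Fin 2) (Fin 2) F)).flip 1
  have h1 : ∀ d, τ (d ⊗ₜ 1) = θ d ⊗ₜ 1 := by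
    intro d
    have cE : τ (d ⊗ₜ 1) * (1 ⊗ₜ mE F) = (1 ⊗ₜ mE F) * τ (d ⊗ₜ 1) := by
      conv_lhs => rw [← hE, ← hτ.1]
      conv_rhs => rw [← hE, ← hτ.1]
      simp
    have cG : τ (d ⊗ₜ 1) * (1 ⊗ₜ mG l) = (1 ⊗ₜ mG l) * τ (d ⊗ₜ 1) := by
      have e1 : (1 ⊗ₜ mG l : D ⊗[F] Matrix (Fin 2) (Fin 2) F) = τ (1 ⊗ₜ (-mG l)) := by
        rw [TensorProduct.tmul_neg, map_neg, hG, neg_neg]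
      conv_lhs => rw [e1, ← hτ.1]
      conv_rhs => rw [e1, ← hτ.1]
      congr 1
      rw [Algebra.TensorProduct.tmul_mul_tmul, Algebra.TensorProduct.tmul_mul_tmul, one_mul, mul_one,
        one_mul, mul_one]
    have cE' := congrArg m.symm cE
    have cG' := congrArg m.symm cG
    rw [map_mul, map_mul] at cE' cG'
    set Y := m.symm (τ (d ⊗ₜ 1)) with hY
    have mEs : m.symm (1 ⊗ₜ mE F) = !![1, 0; 0, -1] := by
      change (1:D) • (mE F).map (algebraMap F D) = _
      ext i j; fin_cases i <;> fin_cases j <;> simp [mE]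
    have mGs : m.symm (1 ⊗ₜ mG l) = !![0, algebraMap F D l; 1, 0] := by
      change (1:D) • (mG l).map (algebraMap F D) = _
      ext i j; fin_cases i <;> fin_cases j <;> simp [mG]
    rw [mEs] at cE'
    rw [mGs] at cG'
    have a01 := congrFun (congrFun cE' 0) 1
    have a10 := congrFun (congrFun cE' 1) 0
    have b10 := congrFun (congrFun cG' 1) 0
    simp [Matrix.mul_apply] at a01 a10 b10
    have z : ∀ t : D, t = -t → t = 0 := fun t ht => two_cancel hF (by nth_rewrite 1 [ht]; simp)
    have y01 := z _ (by rw [a01])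
    have y10 := z _ a10
    have hYd : Y = θ d • (1 : Matrix (Fin 2) (Fin 2) F).map (algebraMap F D) := by
      have : θ d = Y 0 0 := rfl
      rw [this]
      ext i j; fin_cases i <;> fin_cases j <;> simp [y01, y10, b10]
    have : Y = m.symm (θ d ⊗ₜ 1) := hYd
    exact m.symm.injective this
  have inj : ∀ x y : D, x ⊗ₜ[F] (1 : Matrix (Fin 2) (Fin 2) F) = y ⊗ₜ 1 → x = y := by
    intro x y hxy
    have h3 := congrFun (congrFun (congrArg m.symm hxy) 0) 0
    change (x • (1 : Matrix (Fin 2) (Fin 2) F).map (algebraMap F D)) 0 0 =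
      (y • (1 : Matrix (Fin 2) (Fin 2) F).map (algebraMap F D)) 0 0 at h3
    simpa using h3
  have hl' : -l ≠ 0 := neg_ne_zero.mpr hl
  have aE : adjInvo F (-l) (mE F) = mE F := by
    rw [adjInvo_apply _ hl']; ext i j; fin_cases i <;> fin_cases j <;> simp [mE]
  have aG : adjInvo F (-l) (mG l) = - mG l := by
    rw [adjInvo_apply _ hl']; ext i j; fin_cases i <;> fin_cases j <;> simp [mG, hl]
  have aEG : adjInvo F (-l) (mE F * mG l) = mE F * mG l := by
    rw [adjInvo_apply _ hl']; ext i j; fin_cases i <;> fin_cases j <;> simp [mE, mG, hl, Matrix.mul_apply]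
  have a1 : adjInvo F (-l) 1 = 1 := by
    rw [adjInvo_apply _ hl']; ext i j; fin_cases i <;> fin_cases j <;> simp
  have t1 : τ 1 = 1 := hτ.map_one'
  have tEG : τ (1 ⊗ₜ (mE F * mG l)) = 1 ⊗ₜ (mE F * mG l) := by
    have : (1 ⊗ₜ (mE F * mG l) : D ⊗[F] Matrix (Fin 2) (Fin 2) F) = (1 ⊗ₜ mE F) * (1 ⊗ₜ mG l) := by
      simp
    rw [this, hτ.1, hE, hG]
    simp only [neg_mul, Algebra.TensorProduct.tmul_mul_tmul, mul_one, ← TensorProduct.tmul_neg]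
    congr 1
    ext i j; fin_cases i <;> fin_cases j <;> simp [mE, mG, Matrix.mul_apply]
  have tM : ∀ X, τ (1 ⊗ₜ X) = 1 ⊗ₜ adjInvo F (-l) X := by
    intro X
    obtain ⟨a, b, c, d, rfl⟩ := mat_decomp X hF hl
    simp only [TensorProduct.tmul_add, TensorProduct.tmul_smul, map_add, map_smul, aE, aG, aEG, a1,
      hE, hG, tEG, TensorProduct.tmul_neg]
    rw [← Algebra.TensorProduct.one_def, t1]
  refine ⟨θ, ⟨?_, ?_⟩, ?_⟩
  · intro x y
    apply inj
    rw [← h1]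
    have : ((x * y) ⊗ₜ 1 : D ⊗[F] Matrix (Fin 2) (Fin 2) F) = (x ⊗ₜ 1) * (y ⊗ₜ 1) := by simp
    rw [this, hτ.1, h1, h1]; simp
  · intro x
    apply inj
    rw [← h1, ← h1, hτ.2]
  · apply TensorProduct.ext'
    intro d X
    have : (d ⊗ₜ X : D ⊗[F] Matrix (Fin 2) (Fin 2) F) = (d ⊗ₜ 1) * (1 ⊗ₜ X) := by simp
    rw [this, hτ.1, h1, tM]; simp

end Conj

section Conclude

variable {F A : Type} [Field F] [Ring A] [Algebra F A]

lemma conj_units [FiniteDimensional F A] [IsSimpleRing A] (hF : (2:F) ≠ 0)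
    {a b c d e g : A} {l : F} (hl : l ≠ 0)
    (aa : a * a = a) (ab : a * b = b) (ba : b * a = 0) (bb : b * b = 0) (bc : b * c = a)
    (cb : c * b = d) (ac : a * c = 0) (ca : c * a = c) (ad : a + d = 1) (bd : b * d = b)
    (ee : e * e = 1) (gg : g * g = l • 1) (eg : e * g = -(g * e)) :
    ∃ u u' : A, u * u' = 1 ∧ u' * u = 1 ∧ u * (l • b + c) = g * u ∧ u * (a - d) = e * u := by
  obtain ⟨P, hPdef⟩ : ∃ P : A, P = (2:F)⁻¹ • (1 + e) := ⟨_, rfl⟩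
  obtain ⟨S, hSdef⟩ : ∃ S : A, S = (2:F)⁻¹ • (1 - e) := ⟨_, rfl⟩
  have h2 : (2:F)⁻¹ * (2:F)⁻¹ * 2 = (2:F)⁻¹ := by field_simp
  have hPS1 : P + S = 1 := by
    rw [hPdef, hSdef, ← smul_add]
    have : (1 + e + (1 - e)) = (2:F) • (1:A) := by rw [two_smul]; abel
    rw [this, smul_smul, inv_mul_cancel₀ hF, one_smul]
  have hPP : P * P = P := by
    rw [hPdef, smul_mul_smul_comm]
    have : (1 + e) * (1 + e) = (2:F) • (1 + e) := by
      rw [two_smul]; rw [add_mul, mul_add, mul_add, ee]; simp; abel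
    rw [this, smul_smul, h2]
  have hSS : S * S = S := by
    rw [hSdef, smul_mul_smul_comm]
    have : (1 - e) * (1 - e) = (2:F) • (1 - e) := by
      rw [two_smul]; rw [sub_mul, mul_sub, mul_sub, ee]; simp; abel
    rw [this, smul_smul, h2]
  have hgP : g * P = S * g := by
    rw [hPdef, hSdef, mul_smul_comm, smul_mul_assoc, mul_add, sub_mul, eg]; simp
  have hgS : g * S = P * g := by
    rw [hPdef, hSdef, mul_smul_comm, smul_mul_assoc, mul_sub, add_mul, eg]; simp [sub_eq_add_neg]
  have heP : e * P = P := by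
    rw [hPdef, mul_smul_comm, mul_add, ee, mul_one, add_comm]
  have hSP : S * P = 0 := by
    have : S = 1 - P := by rw [← hPS1]; abel
    rw [this, sub_mul, hPP]; simp
  have hPS : P * S = 0 := by
    have : S = 1 - P := by rw [← hPS1]; abel
    rw [this, mul_sub, hPP]; simp
  have hdim1 : Module.finrank F (Lid F P) = Module.finrank F (Lid F S) := by
    apply Lid_eq (x := l⁻¹ • (P * g)) (y := g * P) hPP hSS
    · rw [smul_mul_assoc]
      have : P * g * (g * P) = P * (g * g) * P := by simp only [mul_assoc]
      rw [this, gg, mul_smul_comm, mul_one, smul_mul_assoc, hPP, smul_smul, inv_mul_cancel₀ hl, one_smul]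
    · rw [mul_smul_comm]
      have : g * P * (P * g) = (g * (P * P)) * g := by simp only [mul_assoc]
      rw [this, hPP, hgP, mul_assoc, gg, mul_smul_comm, mul_one, smul_smul, inv_mul_cancel₀ hl, one_smul]
  have dd : d * d = d := by
    rw [← cb, mul_assoc, ← mul_assoc b, bc, ab]
  have da : d * a = 0 := by rw [← cb, mul_assoc, ba, mul_zero]
  have hadd : a * d = 0 := by rw [← cb, ← mul_assoc, ac, zero_mul]
  have hdim2 : Module.finrank F (Lid F a) = Module.finrank F (Lid F d) :=
    Lid_eq (x := b) (y := c) aa dd bc cb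
  have h3 := Lid_add (F := F) hPP hSS hPS hSP
  have h4 := Lid_add (F := F) aa dd hadd da
  rw [hPS1] at h3
  rw [ad] at h4
  obtain ⟨x, y, Px, xa, ay, yP, xy, yx⟩ := idem_iso (F := F) hPP aa (by omega)
  have xc : x * c = 0 := by rw [← xa, mul_assoc, ac, mul_zero]
  have yb : b * y = 0 := by rw [← ay, ← mul_assoc, ba, zero_mul]
  have ex : e * x = x := by rw [← Px, ← mul_assoc, heP]
  have ygx : y * g * x = 0 := by
    rw [← yP, ← Px]
    have : y * P * g * (P * x) = y * (P * (g * P)) * x := by simp only [mul_assoc]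
    rw [this, hgP, ← mul_assoc P, hPS]; simp
  have xby : x * b * c * y = P := by rw [mul_assoc x, bc, xa, xy]
  have hgPg : g * P * g = l • S := by rw [hgP, mul_assoc, gg]; simp
  refine ⟨x + g * x * b, y + l⁻¹ • (c * y * g), ?_, ?_, ?_, ?_⟩
  · rw [add_mul, mul_add, mul_add, mul_smul_comm, mul_smul_comm]
    have t1 : x * (c * y * g) = 0 := by rw [← mul_assoc, ← mul_assoc, xc]; simp
    have t2 : g * x * b * y = 0 := by rw [mul_assoc, yb, mul_zero]
    have t3 : g * x * b * (c * y * g) = g * (x * b * c * y) * g := by simp only [mul_assoc]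
    rw [t1, t2, t3, xby, hgPg, xy, smul_smul, inv_mul_cancel₀ hl, one_smul]
    simpa using hPS1
  · rw [add_mul, mul_add, mul_add, smul_mul_assoc, smul_mul_assoc]
    have t1 : y * (g * x * b) = y * g * x * b := by simp only [mul_assoc]
    have t2 : c * y * g * x = c * (y * g * x) := by simp only [mul_assoc]
    have t3 : c * y * g * (g * x * b) = c * (y * (g * g) * x) * b := by simp only [mul_assoc]
    rw [t1, t2, t3, gg, ygx, yx, mul_smul_comm, mul_one, smul_mul_assoc, yx, mul_smul_comm,
      smul_mul_assoc, ca, cb, smul_smul, inv_mul_cancel₀ hl, one_smul]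
    simpa using ad
  · rw [add_mul, mul_add, mul_add, mul_add]
    have t1 : g * x * b * (l • b) = 0 := by rw [mul_smul_comm, mul_assoc, bb]; simp
    have t2 : g * x * b * c = g * x := by rw [mul_assoc, bc, mul_assoc, xa]
    have t3 : g * (g * x * b) = (g * g) * x * b := by simp only [mul_assoc]
    rw [t1, t2, t3, gg, xc, mul_smul_comm]; simp; abel
  · rw [mul_sub, add_mul, add_mul, mul_add]
    have t1 : g * x * b * a = 0 := by rw [mul_assoc, ba, mul_zero]
    have t2 : g * x * b * d = g * x * b := by rw [mul_assoc, bd]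
    have t3 : e * (g * x * b) = (e * g) * x * b := by simp only [mul_assoc]
    have t4 : x * d = 0 := by rw [← xa, mul_assoc, hadd, mul_zero]
    have t5 : g * e * x * b = g * x * b := by rw [mul_assoc g, ex]
    rw [t1, t2, t3, t4, xa, ex, eg, neg_mul, neg_mul, t5]; abel

/-- Inner automorphism. -/
def innerEquiv {u u' : A} (h : u * u' = 1) (h' : u' * u = 1) : A ≃ₐ[F] A where
  toFun z := u' * z * u
  invFun z := u * z * u'
  left_inv z := by
    have : u * (u' * z * u) * u' = (u * u') * z * (u * u') := by simp only [mul_assoc]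
    simp only [this, h]; simp
  right_inv z := by
    have : u' * (u * z * u') * u = (u' * u) * z * (u' * u) := by simp only [mul_assoc]
    simp only [this, h']; simp
  map_mul' x y := by
    have : u' * x * u * (u' * y * u) = u' * x * (u * u') * y * u := by simp only [mul_assoc]
    rw [this, h]; simp [mul_assoc]
  map_add' x y := by rw [mul_add, add_mul]
  commutes' r := by rw [← Algebra.commutes, mul_assoc, h', mul_one]

lemma innerEquiv_apply {u u' : A} (h : u * u' = 1) (h' : u' * u = 1) (z : A) :
    innerEquiv (F := F) h h' z = u' * z * u := rfl

lemma conclude [FiniteDimensional F A] [IsSimpleRing A] (hF : (2:F) ≠ 0)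
    {σ : A →ₗ[F] A} (hσ : IsInvolution F A σ)
    (h36 : Module.finrank F (symmElements F A σ) = 36) (heg : HasEG F σ)
    {D : Type} [Ring D] [Algebra F D] [FiniteDimensional F D] (hD : Module.finrank F D = 16)
    (ι : A ≃ₐ[F] Matrix (Fin 2) (Fin 2) D)
    (hBQ : ∀ θ : D →ₗ[F] D, IsInvolution F D θ →
      Module.finrank F (symmElements F D θ) = 10 → BiQuat F D) :
    ∃ (lam : F), lam ≠ 0 ∧
      ∃ (a b a' b' : F), a ≠ 0 ∧ b ≠ 0 ∧ a' ≠ 0 ∧ b' ≠ 0 ∧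
        ∃ (θ : (ℍ[F,a,b] ⊗[F] ℍ[F,a',b']) →ₗ[F] (ℍ[F,a,b] ⊗[F] ℍ[F,a',b'])),
          IsOrthogonalInvolution F (ℍ[F,a,b] ⊗[F] ℍ[F,a',b']) θ 4 ∧
          ∃ f : A ≃ₐ[F] ((ℍ[F,a,b] ⊗[F] ℍ[F,a',b']) ⊗[F] Matrix (Fin 2) (Fin 2) F),
            ∀ x, f (σ x) = TensorProduct.map θ (adjInvo F (-lam)) (f x) := by
  obtain ⟨e, g, l, hl, se, ee, sg, gg, eg⟩ := heg
  let m := matrixEquivTensor (Fin 2) F D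
  let ρ : A ≃ₐ[F] D ⊗[F] Matrix (Fin 2) (Fin 2) F := ι.trans m
  let E : Fin 2 → Fin 2 → A := fun i j => ρ.symm (1 ⊗ₜ Matrix.single i j 1)
  have hE : ∀ i j k n, E i j * E k n = if j = k then E i n else 0 := by
    intro i j k n
    simp only [E, ← map_mul, Algebra.TensorProduct.tmul_mul_tmul, mul_one]
    split_ifs with h
    · subst h; rw [Matrix.single_mul_single_same, mul_one]
    · rw [Matrix.single_mul_single_of_ne _ _ _ _ h]; simp
  have hE1 : E 0 0 + E 1 1 = 1 := by
    simp only [E, ← map_add, ← TensorProduct.tmul_add]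
    rw [← map_one ρ.symm, Algebra.TensorProduct.one_def]
    congr 2
    ext i j; fin_cases i <;> fin_cases j <;> simp [Matrix.single]
  obtain ⟨u, u', huu, huu', hug, hue⟩ := conj_units hF hl (a := E 0 0) (b := E 0 1) (c := E 1 0)
    (d := E 1 1) (by simp [hE]) (by simp [hE]) (by simp [hE]) (by simp [hE]) (by simp [hE])
    (by simp [hE]) (by simp [hE]) (by simp [hE]) hE1 (by simp [hE]) ee gg eg
  let ψ : A ≃ₐ[F] D ⊗[F] Matrix (Fin 2) (Fin 2) F := (innerEquiv huu huu').trans ρ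
  have hψe : ψ e = 1 ⊗ₜ mE F := by
    change ρ (u' * e * u) = _
    rw [mul_assoc, ← hue, ← mul_assoc, huu', one_mul, map_sub]
    simp only [E, AlgEquiv.apply_symm_apply, ← TensorProduct.tmul_sub]
    congr 1
    ext i j; fin_cases i <;> fin_cases j <;> simp [mE, Matrix.single]
  have hψg : ψ g = 1 ⊗ₜ mG l := by
    change ρ (u' * g * u) = _
    rw [mul_assoc, ← hug, ← mul_assoc, huu', one_mul, map_add, map_smul]
    simp only [E, AlgEquiv.apply_symm_apply, ← TensorProduct.tmul_smul, ← TensorProduct.tmul_add]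
    congr 1
    ext i j; fin_cases i <;> fin_cases j <;> simp [mG, Matrix.single]
  let τ : D ⊗[F] Matrix (Fin 2) (Fin 2) F →ₗ[F] D ⊗[F] Matrix (Fin 2) (Fin 2) F :=
    ψ.toLinearMap ∘ₗ σ ∘ₗ ψ.symm.toLinearMap
  have hτa : ∀ x, τ x = ψ (σ (ψ.symm x)) := fun x => rfl
  have hτψ : ∀ x, τ (ψ x) = ψ (σ x) := fun x => by rw [hτa, AlgEquiv.symm_apply_apply]
  have hτ : IsInvolution F _ τ := by
    constructor
    · intro x y; simp only [hτa, map_mul, hσ.1]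
    · intro x; rw [hτa, hτa, AlgEquiv.symm_apply_apply, hσ.2, AlgEquiv.apply_symm_apply]
  obtain ⟨θ, hθ, hτθ⟩ := exists_theta hF hl τ hτ (by rw [← hψe, hτψ, se])
    (by rw [← hψg, hτψ, sg, map_neg])
  have h36' : Module.finrank F (symmElements F _ τ) = 36 := by
    rw [← h36]
    have : symmElements F _ τ = (symmElements F A σ).map ψ.toLinearMap := by
      ext x
      rw [mem_symmElements, Submodule.mem_map]
      constructor
      · intro hx
        refine ⟨ψ.symm x, ?_, by simp⟩
        rw [mem_symmElements]
        apply ψ.injective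
        rw [AlgEquiv.apply_symm_apply, ← hτa, hx]
      · rintro ⟨y, hy, rfl⟩
        rw [mem_symmElements] at hy
        change τ (ψ y) = ψ y
        rw [hτψ, hy]
    rw [this]
    exact LinearEquiv.finrank_map_eq ψ.toLinearEquiv _
  obtain ⟨d3, d1⟩ := adj_dims hF l hl
  rw [hτθ, sym_tensor hF θ hθ.2 _ (adj_invol _ (neg_ne_zero.mpr hl)), d3, d1] at h36'
  have hsum := finrank_sym_skew hF θ hθ.2
  have h10 : Module.finrank F (symmElements F D θ) = 10 := by omega
  obtain ⟨a, b, a', b', ha, hb, ha', hb', ⟨κ⟩⟩ := biquat_equiv hF hD (hBQ θ hθ h10)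
  let θ' : (ℍ[F,a,b] ⊗[F] ℍ[F,a',b']) →ₗ[F] (ℍ[F,a,b] ⊗[F] ℍ[F,a',b']) :=
    κ.toLinearMap ∘ₗ θ ∘ₗ κ.symm.toLinearMap
  have hθ'a : ∀ x, θ' x = κ (θ (κ.symm x)) := fun x => rfl
  have hθ' : IsInvolution F _ θ' := by
    constructor
    · intro x y; simp only [hθ'a, map_mul, hθ.1]
    · intro x; rw [hθ'a, hθ'a, AlgEquiv.symm_apply_apply, hθ.2, AlgEquiv.apply_symm_apply]
  refine ⟨l, hl, a, b, a', b', ha, hb, ha', hb', θ', ⟨hθ', ?_⟩,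
    ψ.trans (Algebra.TensorProduct.congr κ AlgEquiv.refl), ?_⟩
  · norm_num
    rw [← h10]
    have : symmElements F _ θ' = (symmElements F D θ).map κ.toLinearMap := by
      ext x
      rw [mem_symmElements, Submodule.mem_map]
      constructor
      · intro hx
        refine ⟨κ.symm x, ?_, by simp⟩
        rw [mem_symmElements]
        apply κ.injective
        rw [AlgEquiv.apply_symm_apply, ← hθ'a, hx]
      · rintro ⟨y, hy, rfl⟩
        rw [mem_symmElements] at hy
        change θ' (κ y) = κ y
        rw [hθ'a, AlgEquiv.symm_apply_apply, hy]
    rw [this]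
    exact LinearEquiv.finrank_map_eq κ.toLinearEquiv _
  · intro x
    change Algebra.TensorProduct.congr κ AlgEquiv.refl (ψ (σ x)) =
      TensorProduct.map θ' (adjInvo F (-l)) (Algebra.TensorProduct.congr κ AlgEquiv.refl (ψ x))
    rw [← hτψ, hτθ]
    generalize ψ x = z
    induction z using TensorProduct.induction_on with
    | zero => simp
    | add x y hx hy => simp only [map_add, hx, hy]
    | tmul d X => simp [hθ'a]

end Conclude

section Core

variable {F : Type} [Field F]

lemma prim_single {D : Type} [DivisionRing D] (n : ℕ) [NeZero n] :
    Prim (Matrix.single (0 : Fin n) (0 : Fin n) (1 : D)) := by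
  have hc : ∀ z : Matrix (Fin n) (Fin n) D, Matrix.single (0 : Fin n) (0 : Fin n) (1 : D) * z *
      Matrix.single (0 : Fin n) (0 : Fin n) (1 : D) = Matrix.single 0 0 (z 0 0) := by
    intro z; simp
  refine ⟨by simp, ⟨n, fun i => Matrix.single i 0 1, fun i => Matrix.single 0 i 1, ?_⟩, ?_⟩
  · simp only [Matrix.single_mul_single_same, mul_one]
    ext i j
    rw [Matrix.sum_apply, Finset.sum_eq_single i]
    · by_cases hij : i = j
      · subst hij; simp
      · simp [hij]
    · intro x _ hx; simp [hx]
    · simp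
  · intro z hz
    rw [hc] at hz
    have hz0 : z 0 0 ≠ 0 := by
      intro h; apply hz; rw [h]; simp
    refine ⟨Matrix.single 0 0 (z 0 0)⁻¹, ?_⟩
    rw [hc, hc, Matrix.single_mul_single_same]
    simp [hz0]

lemma Lid_single {D : Type} [DivisionRing D] [Algebra F D] [FiniteDimensional F D] (n : ℕ)
    [NeZero n] :
    Module.finrank F (Lid F (Matrix.single (0 : Fin n) (0 : Fin n) (1 : D))) =
      n * Module.finrank F D := by
  let φ : (Fin n → D) →ₗ[F] Matrix (Fin n) (Fin n) D :=
    { toFun := fun v => Matrix.of fun i j => if j = 0 then v i else 0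
      map_add' := fun v w => by ext i j; simp; split_ifs <;> simp
      map_smul' := fun r v => by ext i j; simp }
  have hφ : ∀ v i j, φ v i j = if j = 0 then v i else 0 := fun _ _ _ => rfl
  have hinj : Function.Injective φ := by
    intro v w h
    ext i
    have := congrFun (congrFun h i) 0
    simpa [hφ] using this
  have hr : LinearMap.range φ = Lid F (Matrix.single (0 : Fin n) (0 : Fin n) (1 : D)) := by
    ext X
    rw [mem_Lid (by simp)]
    constructor
    · rintro ⟨v, rfl⟩
      ext i j
      by_cases hj : j = 0
      · subst hj; simp [hφ]
      · simp [hφ, hj]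
    · intro h
      refine ⟨fun i => X i 0, ?_⟩
      ext i j
      rw [hφ, ← h]
      by_cases hj : j = 0
      · subst hj; simp
      · simp [hj]
  rw [← hr, LinearMap.finrank_range_of_inj hinj, Module.finrank_pi_fintype]
  simp

lemma Prim.map {A B : Type} [Ring A] [Algebra F A] [Ring B] [Algebra F B] (e : A ≃ₐ[F] B) {p : A}
    (hp : Prim p) : Prim (e p) := by
  refine ⟨by rw [← map_mul, hp.idem], ?_, ?_⟩
  · obtain ⟨m, r, l, h⟩ := hp.gen
    refine ⟨m, fun i => e (r i), fun i => e (l i), ?_⟩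
    simp only [← map_mul, ← map_sum, h, map_one]
  · intro z hz
    have h1 : p * e.symm z * p ≠ 0 := by
      intro h; apply hz
      have := congrArg e h
      simpa using this
    obtain ⟨w, hw⟩ := hp.div _ h1
    refine ⟨e w, ?_⟩
    have := congrArg e hw
    simpa using this

lemma Lid_map {A B : Type} [Ring A] [Algebra F A] [Ring B] [Algebra F B] (e : A ≃ₐ[F] B) {p : A}
    (hp : p * p = p) : Module.finrank F (Lid F (e p)) = Module.finrank F (Lid F p) := by
  have : Lid F (e p) = (Lid F p).map e.toLinearMap := by
    ext x
    rw [mem_Lid (by rw [← map_mul, hp]), Submodule.mem_map]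
    constructor
    · intro h
      refine ⟨e.symm x, ?_, by simp⟩
      rw [mem_Lid hp]
      apply e.injective
      simpa using h
    · rintro ⟨y, hy, rfl⟩
      rw [mem_Lid hp] at hy
      change e y * e p = e y
      rw [← map_mul, hy]
  rw [this]
  exact LinearEquiv.finrank_map_eq e.toLinearEquiv _

lemma exists_eg {A : Type} [Ring A] [Algebra F A] [FiniteDimensional F A] [IsSimpleRing A]
    (hF : (2:F) ≠ 0) {σ : A →ₗ[F] A} (hσ : IsInvolution F A σ) (h64 : Module.finrank F A = 64)
    (h36 : Module.finrank F (symmElements F A σ) = 36)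
    {f : Fin 7 → A} {q : Fin 7 → F} (hs : Seven σ f q)
    {D : Type} [DivisionRing D] [Algebra F D] [FiniteDimensional F D] [Algebra.IsCentral F D]
    (k : ℕ) (hk : 0 < k) (hn : 2 * k * (2 * k) * Module.finrank F D = 64)
    (ε : A ≃ₐ[F] Matrix (Fin (2 * k)) (Fin (2 * k)) D) : HasEG F σ := by
  by_cases haniso : ∀ c : Fin 7 → F, c ≠ 0 → ∑ i, c i * c i * q i ≠ 0
  swap
  · push Not at haniso
    obtain ⟨c, hc, hQ⟩ := haniso
    exact eg_of_iso hF hσ hs hc hQ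
  have : NeZero (2 * k) := ⟨by omega⟩
  set d := Module.finrank F D with hd
  let p0 : Matrix (Fin (2 * k)) (Fin (2 * k)) D := Matrix.single 0 0 1
  have hp0 : Prim p0 := prim_single _
  let p : A := ε.symm p0
  have hp : Prim p := hp0.map ε.symm
  have hLp : Module.finrank F (Lid F p) = 2 * k * d := by
    rw [← Lid_single (F := F) (D := D) (2 * k)]
    exact Lid_map ε.symm hp0.idem
  have hdpos : 0 < d := Module.finrank_pos
  have hpne : p ≠ 0 := by
    intro h
    have : p0 = 0 := by
      have := congrArg ε h
      simpa [p] using this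
    have := congrFun (congrFun this 0) 0
    simp [p0] at this
  obtain ⟨p', hp', hsp', hLp'⟩ := exists_sym_prim hσ hF (by omega) hp hpne (by
    intro hcomm
    have hcD : ∀ x y : D, x * y = y * x := by
      intro x y
      have h := congrArg ε (hcomm (ε.symm (Matrix.single 0 0 x)) (ε.symm (Matrix.single 0 0 y)))
      simp only [p, map_mul, AlgEquiv.apply_symm_apply, p0] at h
      simp at h
      simpa using congrFun (congrFun h 0) 0
    have h1 : d = 1 := by
      rw [hd, finrank_eq_one_iff_of_nonzero' (1:D) one_ne_zero]
      intro w
      obtain ⟨c, hc⟩ := central_scalar (F := F) (hcD w)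
      exact ⟨c, hc.symm⟩
    rw [hLp, h1]
    rw [h1] at hn
    have : k = 4 := by nlinarith
    omega)
  have hp'ne : p' ≠ 0 := by
    intro h
    rw [h] at hLp'
    have h0 : Lid F (0 : A) = ⊥ := by
      rw [eq_bot_iff]; rintro _ ⟨x, rfl⟩; simp
    rw [h0, finrank_bot, hLp] at hLp'
    have : 0 < 2 * k * d := by positivity
    omega
  obtain ⟨P, hPP, hPs, hPdim⟩ := exists_half hσ hF hp' hp'ne hsp' k (by
    intro m hm h
    rw [hLp', hLp, h64, ← hn] at h
    have h2 : m * (2 * k * d) < 2 * k * (2 * k * d) :=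
      Nat.mul_lt_mul_of_pos_right (by omega) (by positivity)
    have : 2 * k * (2 * k) * d = 2 * k * (2 * k * d) := by ring
    omega)
  rw [hLp', hLp] at hPdim
  have h28 := finrank_sym_skew hF σ hσ.2
  refine eg_of_aniso hF h64 (by omega) hs haniso hσ hPP hPs ?_
  rw [hPdim]
  have : 2 * k * (2 * k) * d = 2 * (k * (2 * k * d)) := by ring
  omega

lemma main_abstract {A : Type} [Ring A] [Algebra F A] [FiniteDimensional F A]
    (hF : (2:F) ≠ 0) {σ : A →ₗ[F] A} (hσ : IsInvolution F A σ) (h64 : Module.finrank F A = 64)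
    (h36 : Module.finrank F (symmElements F A σ) = 36)
    {f : Fin 7 → A} {q : Fin 7 → F} (hs : Seven σ f q)
    (hindex : ∃ (B : Type) (_ : Ring B) (_ : Algebra F B),
        Algebra.IsCentral F B ∧ IsSimpleRing B ∧ Module.finrank F B ≤ 16 ∧
        BrauerEquivalent F A B) :
    ∃ (lam : F), lam ≠ 0 ∧
      ∃ (a b a' b' : F), a ≠ 0 ∧ b ≠ 0 ∧ a' ≠ 0 ∧ b' ≠ 0 ∧
        ∃ (θ : (ℍ[F,a,b] ⊗[F] ℍ[F,a',b']) →ₗ[F] (ℍ[F,a,b] ⊗[F] ℍ[F,a',b'])),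
          IsOrthogonalInvolution F (ℍ[F,a,b] ⊗[F] ℍ[F,a',b']) θ 4 ∧
          ∃ f : A ≃ₐ[F] ((ℍ[F,a,b] ⊗[F] ℍ[F,a',b']) ⊗[F] Matrix (Fin 2) (Fin 2) F),
            ∀ x, f (σ x) = TensorProduct.map θ (adjInvo F (-lam)) (f x) := by
  obtain ⟨B, _, _, _, _, hB, D, _, _, n, m, hn, hm, hcent, ⟨ε⟩, ⟨η⟩⟩ := hindex
  have : NeZero n := ⟨hn.ne'⟩
  have hfinM : FiniteDimensional F (Matrix (Fin n) (Fin n) D) :=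
    Module.Finite.equiv ε.toLinearEquiv
  have hfin : FiniteDimensional F D := by
    let ev : Matrix (Fin n) (Fin n) D →ₗ[F] D :=
      { toFun := fun X => X 0 0, map_add' := fun _ _ => rfl, map_smul' := fun _ _ => rfl }
    exact Module.Finite.of_surjective ev (fun d => ⟨fun _ _ => d, rfl⟩)
  have hdpos : 0 < Module.finrank F D := Module.finrank_pos
  have h1 : n * n * Module.finrank F D = 64 := by
    rw [← h64, ε.toLinearEquiv.finrank_eq, Module.finrank_matrix]; simp
  have h2 : m * m * Module.finrank F D ≤ 16 := by
    rw [η.toLinearEquiv.finrank_eq, Module.finrank_matrix] at hB; simpa using hB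
  have h3 : Module.finrank F D ≤ 16 := by
    have : 1 ≤ m * m := Nat.mul_pos hm hm
    nlinarith
  have hsimple : IsSimpleRing A :=
    IsSimpleRing.of_ringEquiv ε.symm.toRingEquiv inferInstance
  have hn8 : n ≤ 8 := by
    by_contra h
    have : 9 * 9 ≤ n * n := Nat.mul_le_mul (by omega) (by omega)
    nlinarith
  have hcases : n = 2 * 1 ∨ n = 2 * 2 ∨ n = 2 * 4 := by
    interval_cases n <;> omega
  rcases hcases with rfl | rfl | rfl
  · have hd : Module.finrank F D = 16 := by omega
    exact conclude hF hσ h36 (exists_eg hF hσ h64 h36 hs 1 (by norm_num) h1 ε) hd ε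
      (fun θ hθ h10 => biquat_div hF hd θ hθ h10)
  · have hd : Module.finrank F D = 4 := by omega
    have heg := exists_eg hF hσ h64 h36 hs 2 (by norm_num) h1 ε
    obtain ⟨a, b, i, j, ha, hb, hi, hj, hji⟩ := quat_of_finrank_four (F := F) (D := D) hF hd
    let ι : A ≃ₐ[F] Matrix (Fin 2) (Fin 2) (Matrix (Fin 2) (Fin 2) D) :=
      ε.trans (((Matrix.compAlgEquiv (Fin 2) (Fin 2) D F).trans
        (Matrix.reindexAlgEquiv F D finProdFinEquiv)).symm)
    exact conclude hF hσ h36 heg (by rw [Module.finrank_matrix, hd]; simp) ι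
      (fun θ hθ h10 => biquat_matrix_quat ha hb hi hj hji)
  · have hd : Module.finrank F D = 1 := by omega
    have heg := exists_eg hF hσ h64 h36 hs 4 (by norm_num) h1 ε
    let ι : A ≃ₐ[F] Matrix (Fin 2) (Fin 2) (Matrix (Fin 4) (Fin 4) D) :=
      ε.trans (((Matrix.compAlgEquiv (Fin 2) (Fin 4) D F).trans
        (Matrix.reindexAlgEquiv F D finProdFinEquiv)).symm)
    exact conclude hF hσ h36 heg (by rw [Module.finrank_matrix, hd]; simp) ι
      (fun θ hθ h10 => biquat_matrix_four)

end Core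

section Setup

variable {F A : Type} [Field F] [Ring A] [Algebra F A]

/-- A quaternion pair. -/
structure QPair (x y : A) (α β : F) : Prop where
  ha : α ≠ 0
  hb : β ≠ 0
  xx : x * x = α • 1
  yy : y * y = β • 1
  yx : y * x = -(x * y)

lemma com_assoc {x y : A} (h : y * x = x * y) (z : A) : y * (x * z) = x * (y * z) := by
  rw [← mul_assoc, h, mul_assoc]

lemma seven_ooo {σ : A →ₗ[F] A} (hσ : IsInvolution F A σ) {x₁ y₁ x₂ y₂ x₃ y₃ : A}
    {α₁ β₁ α₂ β₂ α₃ β₃ : F} (p₁ : QPair x₁ y₁ α₁ β₁) (p₂ : QPair x₂ y₂ α₂ β₂)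
    (p₃ : QPair x₃ y₃ α₃ β₃)
    (c1 : x₂ * x₁ = x₁ * x₂) (c2 : x₂ * y₁ = y₁ * x₂) (c3 : y₂ * x₁ = x₁ * y₂)
    (c4 : y₂ * y₁ = y₁ * y₂)
    (d1 : x₃ * x₁ = x₁ * x₃) (d2 : x₃ * y₁ = y₁ * x₃) (d3 : y₃ * x₁ = x₁ * y₃)
    (d4 : y₃ * y₁ = y₁ * y₃)
    (e1 : x₃ * x₂ = x₂ * x₃) (e2 : x₃ * y₂ = y₂ * x₃) (e3 : y₃ * x₂ = x₂ * y₃)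
    (e4 : y₃ * y₂ = y₂ * y₃)
    (sx₁ : σ x₁ = x₁) (sy₁ : σ y₁ = y₁) (sx₂ : σ x₂ = x₂) (sy₂ : σ y₂ = y₂)
    (sx₃ : σ x₃ = x₃) (sy₃ : σ y₃ = y₃) :
    ∃ (f : Fin 7 → A) (q : Fin 7 → F), Seven σ f q := by
  obtain ⟨a1, b1, xx1, yy1, yx1⟩ := p₁
  obtain ⟨a2, b2, xx2, yy2, yx2⟩ := p₂
  obtain ⟨a3, b3, xx3, yy3, yx3⟩ := p₃
  have c1' := com_assoc c1
  have c2' := com_assoc c2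
  have c3' := com_assoc c3
  have c4' := com_assoc c4
  have d1' := com_assoc d1
  have d2' := com_assoc d2
  have d3' := com_assoc d3
  have d4' := com_assoc d4
  have e1' := com_assoc e1
  have e2' := com_assoc e2
  have e3' := com_assoc e3
  have e4' := com_assoc e4
  have xx1' := assoc_sq xx1
  have xx2' := assoc_sq xx2
  have xx3' := assoc_sq xx3
  have yy1' := assoc_sq yy1
  have yy2' := assoc_sq yy2
  have yy3' := assoc_sq yy3
  have yx1' := assoc_anti yx1
  have yx2' := assoc_anti yx2
  have yx3' := assoc_anti yx3
  refine ⟨![x₁ * y₁ * x₃, x₁ * y₁ * y₃, x₁ * x₂ * y₂, y₁ * x₂ * y₂, x₂ * x₃ * y₃, y₂ * x₃ * y₃,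
      x₁ * y₁ * x₂ * y₂ * x₃ * y₃],
    ![-(α₁ * β₁ * α₃), -(α₁ * β₁ * β₃), -(α₁ * α₂ * β₂), -(β₁ * α₂ * β₂), -(α₂ * α₃ * β₃),
      -(β₂ * α₃ * β₃), -(α₁ * β₁ * α₂ * β₂ * α₃ * β₃)], ?_, ?_, ?_, ?_⟩
  · intro i; fin_cases i <;> simp [a1, a2, a3, b1, b2, b3]
  · intro i
    fin_cases i <;>
    simp [hσ.1, sx₁, sy₁, sx₂, sy₂, sx₃, sy₃, mul_assoc, c1, c2, c3, c4, d1, d2, d3, d4,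
      e1, e2, e3, e4, c1', c2', c3', c4', d1', d2', d3', d4', e1', e2', e3', e4', yx1, yx2, yx3,
      yx1', yx2', yx3']
  · intro i
    fin_cases i <;>
    simp [mul_assoc, c1, c2, c3, c4, d1, d2, d3, d4,
      e1, e2, e3, e4, c1', c2', c3', c4', d1', d2', d3', d4', e1', e2', e3', e4', yx1, yx2, yx3,
      yx1', yx2', yx3', xx1, xx2, xx3, yy1, yy2, yy3, xx1', xx2', xx3', yy1', yy2', yy3', smul_smul] <;>
    (try congr 1) <;> ring
  · intro i j hij
    fin_cases i <;> fin_cases j <;> first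
    | exact absurd rfl hij
    | simp only [Fin.mk_zero, Fin.mk_one, Fin.reduceFinMk, Fin.zero_eta, Fin.isValue,
        Matrix.cons_val, Matrix.cons_val_zero, Matrix.cons_val_one, mul_assoc,
        c1, c2, c3, c4, d1, d2, d3, d4,
        e1, e2, e3, e4, c1', c2', c3', c4', d1', d2', d3', d4', e1', e2', e3', e4', yx1, yx2, yx3,
        yx1', yx2', yx3', mul_neg, neg_neg]

lemma seven_sso {σ : A →ₗ[F] A} (hσ : IsInvolution F A σ) {x₁ y₁ x₂ y₂ x₃ y₃ : A}
    {α₁ β₁ α₂ β₂ α₃ β₃ : F} (p₁ : QPair x₁ y₁ α₁ β₁) (p₂ : QPair x₂ y₂ α₂ β₂)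
    (p₃ : QPair x₃ y₃ α₃ β₃)
    (c1 : x₂ * x₁ = x₁ * x₂) (c2 : x₂ * y₁ = y₁ * x₂) (c3 : y₂ * x₁ = x₁ * y₂)
    (c4 : y₂ * y₁ = y₁ * y₂)
    (d1 : x₃ * x₁ = x₁ * x₃) (d2 : x₃ * y₁ = y₁ * x₃) (d3 : y₃ * x₁ = x₁ * y₃)
    (d4 : y₃ * y₁ = y₁ * y₃)
    (e1 : x₃ * x₂ = x₂ * x₃) (e2 : x₃ * y₂ = y₂ * x₃) (e3 : y₃ * x₂ = x₂ * y₃)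
    (e4 : y₃ * y₂ = y₂ * y₃)
    (sx₁ : σ x₁ = -x₁) (sy₁ : σ y₁ = -y₁) (sx₂ : σ x₂ = -x₂) (sy₂ : σ y₂ = -y₂)
    (sx₃ : σ x₃ = x₃) (sy₃ : σ y₃ = y₃) :
    ∃ (f : Fin 7 → A) (q : Fin 7 → F), Seven σ f q := by
  obtain ⟨a1, b1, xx1, yy1, yx1⟩ := p₁
  obtain ⟨a2, b2, xx2, yy2, yx2⟩ := p₂
  obtain ⟨a3, b3, xx3, yy3, yx3⟩ := p₃
  have c1' := com_assoc c1
  have c2' := com_assoc c2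
  have c3' := com_assoc c3
  have c4' := com_assoc c4
  have d1' := com_assoc d1
  have d2' := com_assoc d2
  have d3' := com_assoc d3
  have d4' := com_assoc d4
  have e1' := com_assoc e1
  have e2' := com_assoc e2
  have e3' := com_assoc e3
  have e4' := com_assoc e4
  have xx1' := assoc_sq xx1
  have xx2' := assoc_sq xx2
  have xx3' := assoc_sq xx3
  have yy1' := assoc_sq yy1
  have yy2' := assoc_sq yy2
  have yy3' := assoc_sq yy3
  have yx1' := assoc_anti yx1
  have yx2' := assoc_anti yx2
  have yx3' := assoc_anti yx3
  refine ⟨![x₁ * x₃, y₁ * x₃, x₁ * y₁ * x₃, x₂ * y₃, y₂ * y₃, x₂ * y₂ * y₃, x₃ * y₃],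
    ![α₁ * α₃, β₁ * α₃, -(α₁ * β₁ * α₃), α₂ * β₃, β₂ * β₃, -(α₂ * β₂ * β₃), -(α₃ * β₃)],
    ?_, ?_, ?_, ?_⟩
  · intro i; fin_cases i <;> simp [a1, a2, a3, b1, b2, b3]
  · intro i
    fin_cases i <;>
    simp [hσ.1, sx₁, sy₁, sx₂, sy₂, sx₃, sy₃, mul_assoc, c1, c2, c3, c4, d1, d2, d3, d4,
      e1, e2, e3, e4, c1', c2', c3', c4', d1', d2', d3', d4', e1', e2', e3', e4', yx1, yx2, yx3,
      yx1', yx2', yx3']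
  · intro i
    fin_cases i <;>
    simp [mul_assoc, c1, c2, c3, c4, d1, d2, d3, d4,
      e1, e2, e3, e4, c1', c2', c3', c4', d1', d2', d3', d4', e1', e2', e3', e4', yx1, yx2, yx3,
      yx1', yx2', yx3', xx1, xx2, xx3, yy1, yy2, yy3, xx1', xx2', xx3', yy1', yy2', yy3', smul_smul] <;>
    (try congr 1) <;> ring
  · intro i j hij
    fin_cases i <;> fin_cases j <;> first
    | exact absurd rfl hij
    | simp only [Fin.mk_zero, Fin.mk_one, Fin.reduceFinMk, Fin.zero_eta, Fin.isValue,
        Matrix.cons_val, Matrix.cons_val_zero, Matrix.cons_val_one, mul_assoc,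
        c1, c2, c3, c4, d1, d2, d3, d4,
        e1, e2, e3, e4, c1', c2', c3', c4', d1', d2', d3', d4', e1', e2', e3', e4', yx1, yx2, yx3,
        yx1', yx2', yx3', mul_neg, neg_neg, xx1, xx2, xx3, yy1, yy2, yy3, xx1', xx2', xx3', yy1',
        yy2', yy3', mul_smul_comm, smul_mul_assoc, smul_neg]

end Setup

section Classify

variable {F : Type} [Field F]

lemma sym_finrank_pair {H : Type} [Ring H] [Nontrivial H] [Algebra F H] [FiniteDimensional F H] (hF : (2:F) ≠ 0)
    (h4 : Module.finrank F H = 4) {σ : H →ₗ[F] H} (hσ : IsInvolution F H σ)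
    {x y : H} {α β : F} (p : QPair x y α β) :
    (σ x = x → σ y = y → Module.finrank F (symmElements F H σ) = 3) ∧
    (σ x = -x → σ y = -y → Module.finrank F (symmElements F H σ) = 1) := by
  have hli : LinearIndependent F ![1, x, y, x * y] := by
    rw [Fintype.linearIndependent_iff]
    intro g hg
    simp only [Fin.sum_univ_four, Matrix.cons_val_zero, Matrix.cons_val_one, Matrix.cons_val] at hg
    have hc : ∀ (r : F) (z : H), z * (r • (1:H)) = (r • (1:H)) * z := by intro r z; simp
    obtain ⟨q0, q1, q2, q3⟩ := quat_indep hF p.ha p.hb p.xx p.yy p.yx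
      (c0 := g 0 • (1:H)) (c1 := g 1 • (1:H)) (c2 := g 2 • (1:H)) (c3 := g 3 • (1:H))
      (hc _ _) (hc _ _) (hc _ _) (hc _ _) (hc _ _) (hc _ _) (hc _ _) (hc _ _)
      (by simpa using hg)
    have z : ∀ r : F, r • (1:H) = 0 → r = 0 := fun r hr =>
      (smul_eq_zero.mp hr).resolve_right one_ne_zero
    intro i
    fin_cases i
    · exact z _ q0
    · exact z _ q1
    · exact z _ q2
    · exact z _ q3
  let b := basisOfLinearIndependentOfCardEqFinrank hli (by simp [h4])
  have hb : ∀ i, b i = ![1, x, y, x * y] i := fun i => by simp [b]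
  have h1 : σ 1 = 1 := hσ.map_one'
  constructor
  · intro sx sy
    rw [sym_card hF b (fun i => i ≠ 3) σ]
    · rfl
    · intro i; rw [hb]
      fin_cases i <;> simp [h1, sx, sy, hσ.1, p.yx]
  · intro sx sy
    rw [sym_card hF b (fun i => i = 0) σ]
    · rfl
    · intro i; rw [hb]
      fin_cases i <;> simp [h1, sx, sy, hσ.1, p.yx]

variable {a b : F}

/-- The norm-type form on pure quaternions. -/
def nf (x : ℍ[F,a,b]) : F := a * x.imI ^ 2 + b * x.imJ ^ 2 - a * b * x.imK ^ 2

lemma pure_sq (x : ℍ[F,a,b]) (hx : x.re = 0) : x * x = nf x • 1 := by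
  ext <;> simp [nf, hx] <;> ring

lemma smul_one_inj {r s : F} (h : r • (1 : ℍ[F,a,b]) = s • 1) : r = s := by
  have := congrArg QuaternionAlgebra.re h
  simpa using this

lemma pure_of_sq (hF : (2:F) ≠ 0) {x : ℍ[F,a,b]} {s : F} (h : x * x = s • 1) :
    x.re = 0 ∨ x = x.re • 1 := by
  by_cases hr : x.re = 0
  · exact Or.inl hr
  right
  have hI := congrArg QuaternionAlgebra.imI h
  have hJ := congrArg QuaternionAlgebra.imJ h
  have hK := congrArg QuaternionAlgebra.imK h
  simp at hI hJ hK
  have e1 : x.imI = 0 := by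
    have : 2 * x.re * x.imI = 0 := by linear_combination hI
    simpa [hF, hr] using this
  have e2 : x.imJ = 0 := by
    have : 2 * x.re * x.imJ = 0 := by linear_combination hJ
    simpa [hF, hr] using this
  have e3 : x.imK = 0 := by
    have : 2 * x.re * x.imK = 0 := by linear_combination hK
    simpa [hF, hr] using this
  ext <;> simp [e1, e2, e3]

lemma invo_pure (hF : (2:F) ≠ 0) {σ : ℍ[F,a,b] →ₗ[F] ℍ[F,a,b]} (hσ : IsInvolution F _ σ)
    {x : ℍ[F,a,b]} (hx : x.re = 0) : (σ x).re = 0 := by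
  have h1 : σ 1 = 1 := hσ.map_one'
  have h : σ x * σ x = nf x • 1 := by rw [← hσ.1, pure_sq x hx, map_smul, h1]
  rcases pure_of_sq hF h with h | h
  · exact h
  · have h2 := congrArg σ h
    rw [hσ.2, map_smul, h1] at h2
    have h3 := congrArg QuaternionAlgebra.re h2
    simpa [hx] using h3.symm

lemma eigen_step (hF : (2:F) ≠ 0) {σ : ℍ[F,a,b] →ₗ[F] ℍ[F,a,b]} (hσ : IsInvolution F _ σ)
    {x : ℍ[F,a,b]} (hx : x.re = 0) (hn : nf x ≠ 0) :
    ∃ y, (y = x + σ x ∧ σ y = y ∨ y = x - σ x ∧ σ y = -y) ∧ y.re = 0 ∧ nf y ≠ 0 := by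
  have hs := invo_pure hF hσ hx
  have h1 : σ 1 = 1 := hσ.map_one'
  have r1 : (x + σ x).re = 0 := by simp [hx, hs]
  have r2 : (x - σ x).re = 0 := by simp [hx, hs]
  have hss : σ x * σ x = nf x • 1 := by rw [← hσ.1, pure_sq x hx, map_smul, h1]
  have hsum : nf (x + σ x) + nf (x - σ x) = 4 * nf x := by
    apply smul_one_inj (a := a) (b := b)
    rw [add_smul, ← pure_sq _ r1, ← pure_sq _ r2]
    have : (x + σ x) * (x + σ x) + (x - σ x) * (x - σ x) = 2 • (x * x) + 2 • (σ x * σ x) := by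
      noncomm_ring
    rw [this, hss, pure_sq x hx]
    module
  by_cases h : nf (x + σ x) = 0
  · refine ⟨x - σ x, Or.inr ⟨rfl, by rw [map_sub, hσ.2]; abel⟩, r2, ?_⟩
    rw [h, zero_add] at hsum
    rw [hsum]
    have : (4:F) ≠ 0 := by
      have : (4:F) = 2 * 2 := by norm_num
      rw [this]; exact mul_ne_zero hF hF
    exact mul_ne_zero this hn
  · exact ⟨x + σ x, Or.inl ⟨rfl, by rw [map_add, hσ.2]; abel⟩, r1, h⟩

lemma exists_anti (hF : (2:F) ≠ 0) (ha : a ≠ 0) (hb : b ≠ 0) {u : ℍ[F,a,b]} (hu : u.re = 0) (hn : nf u ≠ 0) :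
    ∃ x : ℍ[F,a,b], x.re = 0 ∧ nf x ≠ 0 ∧ x * u = -(u * x) := by
  by_contra hcon
  push Not at hcon
  have key : ∀ y : ℍ[F,a,b], nf (u * y - y * u) = 0 := by
    intro y
    by_contra h
    refine hcon (u * y - y * u) ?_ h ?_
    · simp; ring
    · have e : u * u = nf u • 1 := pure_sq u hu
      have : (u * y - y * u) * u + u * (u * y - y * u) = (u * u) * y - y * (u * u) := by
        noncomm_ring
      rw [e] at this
      simp at this
      exact eq_neg_of_add_eq_zero_left this
  have kI := key ⟨0, 1, 0, 0⟩
  have kJ := key ⟨0, 0, 1, 0⟩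
  have kK := key ⟨0, 0, 0, 1⟩
  apply hn
  simp [nf] at kI kJ kK ⊢
  have h2 : (4:F) * (2:F) ≠ 0 := by
    have : (4:F) * 2 = 2 * 2 * 2 := by norm_num
    rw [this]; exact mul_ne_zero (mul_ne_zero hF hF) hF
  have hab : (4:F) * 2 * (a * b) ≠ 0 := mul_ne_zero h2 (mul_ne_zero ha hb)
  refine (mul_eq_zero.mp ?_).resolve_left hab
  linear_combination kK - b * kI - a * kJ

lemma classify (hF : (2:F) ≠ 0) (ha : a ≠ 0) (hb : b ≠ 0) {σ : ℍ[F,a,b] →ₗ[F] ℍ[F,a,b]}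
    (hσ : IsInvolution F _ σ) :
    ∃ (x y : ℍ[F,a,b]) (α β : F), QPair x y α β ∧ ((σ x = x ∧ σ y = y) ∨ (σ x = -x ∧ σ y = -y)) := by
  obtain ⟨u, hu, hur, hun⟩ := eigen_step hF hσ (x := ⟨0, 1, 0, 0⟩) rfl (by simp [nf, ha])
  have hu' : σ u = u ∨ σ u = -u := hu.imp And.right And.right
  obtain ⟨x, hxr, hxn, hxu⟩ := exists_anti hF ha hb hur hun
  have hσxu : σ x * u = -(u * σ x) := by
    have h := congrArg σ hxu
    rw [map_neg, hσ.1, hσ.1] at h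
    rcases hu' with h' | h' <;> rw [h'] at h
    · rw [h, neg_neg]
    · simp at h
      exact h.symm
  obtain ⟨v, hv, hvr, hvn⟩ := eigen_step hF hσ hxr hxn
  have hv' : σ v = v ∨ σ v = -v := hv.imp And.right And.right
  have hvu : v * u = -(u * v) := by
    rcases hv with ⟨h, _⟩ | ⟨h, _⟩
    · rw [h, add_mul, mul_add, hxu, hσxu]; abel
    · rw [h, sub_mul, mul_sub, hxu, hσxu]; abel
  have uu := pure_sq u hur
  have vv := pure_sq v hvr
  have ww : (u * v) * (u * v) = (-(nf u * nf v)) • 1 := by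
    rw [mul_assoc, assoc_anti hvu, vv, mul_neg, ← mul_assoc, uu]
    simp [smul_smul, mul_comm]
  have hw : -(nf u * nf v) ≠ 0 := neg_ne_zero.mpr (mul_ne_zero hun hvn)
  rcases hu' with su | su <;> rcases hv' with sv | sv
  · exact ⟨u, v, _, _, ⟨hun, hvn, uu, vv, hvu⟩, Or.inl ⟨su, sv⟩⟩
  · refine ⟨u, u * v, _, _, ⟨hun, hw, uu, ww, ?_⟩, Or.inl ⟨su, ?_⟩⟩
    · rw [mul_assoc, hvu, mul_neg]
    · rw [hσ.1, su, sv, neg_mul, hvu, neg_neg]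
  · refine ⟨v, u * v, _, _, ⟨hvn, hw, vv, ww, ?_⟩, Or.inl ⟨sv, ?_⟩⟩
    · rw [← mul_assoc v, hvu, neg_mul, neg_neg]
    · rw [hσ.1, su, sv, mul_neg, hvu, neg_neg]
  · exact ⟨u, v, _, _, ⟨hun, hvn, uu, vv, hvu⟩, Or.inr ⟨su, sv⟩⟩

end Classify

section Final

variable {F : Type} [Field F]

lemma QPair.map {H A : Type} [Ring H] [Algebra F H] [Ring A] [Algebra F A] (j : H →ₐ[F] A)
    {x y : H} {α β : F} (p : QPair x y α β) : QPair (j x) (j y) α β := by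
  refine ⟨p.ha, p.hb, ?_, ?_, ?_⟩
  · rw [← map_mul, p.xx, map_smul, map_one]
  · rw [← map_mul, p.yy, map_smul, map_one]
  · rw [← map_mul, p.yx, map_neg, map_mul]

lemma parity_arith {S1 Z1 S2 Z2 S3 Z3 S Z w1 w2 w3 : ℕ} (k12 : S = S1 * S2 + Z1 * Z2)
    (k123 : 36 = S * S3 + Z * Z3) (s1 : S1 + Z1 = 4) (s2 : S2 + Z2 = 4) (s3 : S3 + Z3 = 4)
    (s12 : S + Z = 4 * 4) (h1 : S1 = w1) (h2 : S2 = w2) (h3 : S3 = w3) :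
    36 = (w1 * w2 + (4 - w1) * (4 - w2)) * w3 +
      (16 - (w1 * w2 + (4 - w1) * (4 - w2))) * (4 - w3) := by
  subst h1 h2 h3
  have e1 : Z1 = 4 - S1 := by omega
  have e2 : Z2 = 4 - S2 := by omega
  have e3 : Z3 = 4 - S3 := by omega
  have e4 : Z = 16 - S := by omega
  rw [e4, e3] at k123
  rw [e1, e2] at k12
  rw [k12] at k123
  exact k123

end Final

/-- **Decomposability theorem.** A totally decomposable orthogonal involution on a degree 8
algebra of index ≤ 4 decomposes as `(D,θ) ⊗ Ad_⟨⟨λ⟩⟩` with `D` a biquaternion algebra. -/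
theorem degree8_index4_decomposition
    (F : Type) [Field F] (hF : (2:F) ≠ 0)
    (a₁ b₁ a₂ b₂ a₃ b₃ : F)
    (ha₁ : a₁ ≠ 0) (hb₁ : b₁ ≠ 0) (ha₂ : a₂ ≠ 0) (hb₂ : b₂ ≠ 0) (ha₃ : a₃ ≠ 0) (hb₃ : b₃ ≠ 0)
    (σ₁ : ℍ[F,a₁,b₁] →ₗ[F] ℍ[F,a₁,b₁]) (hσ₁ : IsInvolution F _ σ₁)
    (σ₂ : ℍ[F,a₂,b₂] →ₗ[F] ℍ[F,a₂,b₂]) (hσ₂ : IsInvolution F _ σ₂)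
    (σ₃ : ℍ[F,a₃,b₃] →ₗ[F] ℍ[F,a₃,b₃]) (hσ₃ : IsInvolution F _ σ₃)
    (horth : IsOrthogonalInvolution F ((ℍ[F,a₁,b₁] ⊗[F] ℍ[F,a₂,b₂]) ⊗[F] ℍ[F,a₃,b₃])
      (TensorProduct.map (TensorProduct.map σ₁ σ₂) σ₃) 8)
    (hindex : ∃ (B : Type) (_ : Ring B) (_ : Algebra F B),
        Algebra.IsCentral F B ∧ IsSimpleRing B ∧ Module.finrank F B ≤ 16 ∧
        BrauerEquivalent F ((ℍ[F,a₁,b₁] ⊗[F] ℍ[F,a₂,b₂]) ⊗[F] ℍ[F,a₃,b₃]) B) :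
    ∃ (lam : F), lam ≠ 0 ∧
      ∃ (a b a' b' : F), a ≠ 0 ∧ b ≠ 0 ∧ a' ≠ 0 ∧ b' ≠ 0 ∧
        ∃ (θ : (ℍ[F,a,b] ⊗[F] ℍ[F,a',b']) →ₗ[F] (ℍ[F,a,b] ⊗[F] ℍ[F,a',b'])),
          IsOrthogonalInvolution F (ℍ[F,a,b] ⊗[F] ℍ[F,a',b']) θ 4 ∧
          ∃ f : ((ℍ[F,a₁,b₁] ⊗[F] ℍ[F,a₂,b₂]) ⊗[F] ℍ[F,a₃,b₃]) ≃ₐ[F]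
              ((ℍ[F,a,b] ⊗[F] ℍ[F,a',b']) ⊗[F] Matrix (Fin 2) (Fin 2) F),
            ∀ x, f (TensorProduct.map (TensorProduct.map σ₁ σ₂) σ₃ x) =
              TensorProduct.map θ (adjInvo F (-lam)) (f x) := by
  have h36 := horth.2
  norm_num at h36
  have f₁ : Module.finrank F ℍ[F,a₁,b₁] = 4 := QuaternionAlgebra.finrank_eq_four _ _ _
  have f₂ : Module.finrank F ℍ[F,a₂,b₂] = 4 := QuaternionAlgebra.finrank_eq_four _ _ _
  have f₃ : Module.finrank F ℍ[F,a₃,b₃] = 4 := QuaternionAlgebra.finrank_eq_four _ _ _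
  have h64 : Module.finrank F ((ℍ[F,a₁,b₁] ⊗[F] ℍ[F,a₂,b₂]) ⊗[F] ℍ[F,a₃,b₃]) = 64 := by
    rw [Module.finrank_tensorProduct, Module.finrank_tensorProduct, f₁, f₂, f₃]
  have h12 : ∀ x, TensorProduct.map σ₁ σ₂ (TensorProduct.map σ₁ σ₂ x) = x := by
    intro x
    induction x using TensorProduct.induction_on with
    | zero => simp
    | tmul x y => simp [hσ₁.2, hσ₂.2]
    | add x y hx hy => rw [map_add, map_add, hx, hy]
  have k12 := sym_tensor hF σ₁ hσ₁.2 σ₂ hσ₂.2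
  have k123 := sym_tensor hF _ h12 σ₃ hσ₃.2
  have s₁ := finrank_sym_skew hF σ₁ hσ₁.2
  have s₂ := finrank_sym_skew hF σ₂ hσ₂.2
  have s₃ := finrank_sym_skew hF σ₃ hσ₃.2
  have s12 := finrank_sym_skew hF _ h12
  rw [f₁] at s₁
  rw [f₂] at s₂
  rw [f₃] at s₃
  rw [Module.finrank_tensorProduct, f₁, f₂] at s12
  rw [h36] at k123
  have o₁ := hσ₁.map_one'
  have o₂ := hσ₂.map_one'
  have o₃ := hσ₃.map_one'
  obtain ⟨x₁, y₁, α₁, β₁, p₁, t₁⟩ := classify hF ha₁ hb₁ hσ₁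
  obtain ⟨x₂, y₂, α₂, β₂, p₂, t₂⟩ := classify hF ha₂ hb₂ hσ₂
  obtain ⟨x₃, y₃, α₃, β₃, p₃, t₃⟩ := classify hF ha₃ hb₃ hσ₃
  obtain ⟨u₁, v₁⟩ := sym_finrank_pair hF f₁ hσ₁ p₁
  obtain ⟨u₂, v₂⟩ := sym_finrank_pair hF f₂ hσ₂ p₂
  obtain ⟨u₃, v₃⟩ := sym_finrank_pair hF f₃ hσ₃ p₃
  let j₁ : ℍ[F,a₁,b₁] →ₐ[F] ((ℍ[F,a₁,b₁] ⊗[F] ℍ[F,a₂,b₂]) ⊗[F] ℍ[F,a₃,b₃]) :=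
    Algebra.TensorProduct.includeLeft.comp Algebra.TensorProduct.includeLeft
  let j₂ : ℍ[F,a₂,b₂] →ₐ[F] ((ℍ[F,a₁,b₁] ⊗[F] ℍ[F,a₂,b₂]) ⊗[F] ℍ[F,a₃,b₃]) :=
    Algebra.TensorProduct.includeLeft.comp Algebra.TensorProduct.includeRight
  let j₃ : ℍ[F,a₃,b₃] →ₐ[F] ((ℍ[F,a₁,b₁] ⊗[F] ℍ[F,a₂,b₂]) ⊗[F] ℍ[F,a₃,b₃]) :=
    Algebra.TensorProduct.includeRight
  have e₁ : ∀ x, j₁ x = (x ⊗ₜ 1) ⊗ₜ 1 := fun _ => rfl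
  have e₂ : ∀ x, j₂ x = (1 ⊗ₜ x) ⊗ₜ 1 := fun _ => rfl
  have e₃ : ∀ x, j₃ x = 1 ⊗ₜ x := fun _ => rfl
  have c21 : ∀ x y, j₂ x * j₁ y = j₁ y * j₂ x := by intro x y; simp [e₁, e₂]
  have c31 : ∀ x y, j₃ x * j₁ y = j₁ y * j₃ x := by intro x y; simp [e₁, e₃]
  have c32 : ∀ x y, j₃ x * j₂ y = j₂ y * j₃ x := by intro x y; simp [e₂, e₃]
  have g₁ : ∀ x, TensorProduct.map (TensorProduct.map σ₁ σ₂) σ₃ (j₁ x) = j₁ (σ₁ x) := by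
    intro x; simp [e₁, o₂, o₃]
  have g₂ : ∀ x, TensorProduct.map (TensorProduct.map σ₁ σ₂) σ₃ (j₂ x) = j₂ (σ₂ x) := by
    intro x; simp [e₂, o₁, o₃]
  have g₃ : ∀ x, TensorProduct.map (TensorProduct.map σ₁ σ₂) σ₃ (j₃ x) = j₃ (σ₃ x) := by
    intro x; simp [e₃, Algebra.TensorProduct.one_def, o₁, o₂]
  have hs : ∃ (f : Fin 7 → ((ℍ[F,a₁,b₁] ⊗[F] ℍ[F,a₂,b₂]) ⊗[F] ℍ[F,a₃,b₃]))
      (q : Fin 7 → F), Seven (F := F) (A := (ℍ[F,a₁,b₁] ⊗[F] ℍ[F,a₂,b₂]) ⊗[F] ℍ[F,a₃,b₃])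
        (TensorProduct.map (TensorProduct.map σ₁ σ₂) σ₃) f q := by
    have P₁ := p₁.map (A := (ℍ[F,a₁,b₁] ⊗[F] ℍ[F,a₂,b₂]) ⊗[F] ℍ[F,a₃,b₃]) j₁
    have P₂ := p₂.map (A := (ℍ[F,a₁,b₁] ⊗[F] ℍ[F,a₂,b₂]) ⊗[F] ℍ[F,a₃,b₃]) j₂
    have P₃ := p₃.map (A := (ℍ[F,a₁,b₁] ⊗[F] ℍ[F,a₂,b₂]) ⊗[F] ℍ[F,a₃,b₃]) j₃
    rcases t₁ with ⟨r₁, w₁⟩ | ⟨r₁, w₁⟩ <;> rcases t₂ with ⟨r₂, w₂⟩ | ⟨r₂, w₂⟩ <;>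
      rcases t₃ with ⟨r₃, w₃⟩ | ⟨r₃, w₃⟩
    · exact seven_ooo horth.1 P₁ P₂ P₃ (c21 _ _) (c21 _ _) (c21 _ _) (c21 _ _)
        (c31 _ _) (c31 _ _) (c31 _ _) (c31 _ _) (c32 _ _) (c32 _ _) (c32 _ _) (c32 _ _)
        (by rw [g₁, r₁]) (by rw [g₁, w₁]) (by rw [g₂, r₂]) (by rw [g₂, w₂])
        (by rw [g₃, r₃]) (by rw [g₃, w₃])
    · exact absurd (parity_arith k12 k123 s₁ s₂ s₃ s12 (u₁ r₁ w₁) (u₂ r₂ w₂) (v₃ r₃ w₃)) (by norm_num)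
    · exact absurd (parity_arith k12 k123 s₁ s₂ s₃ s12 (u₁ r₁ w₁) (v₂ r₂ w₂) (u₃ r₃ w₃)) (by norm_num)
    · exact seven_sso horth.1 P₂ P₃ P₁ (c32 _ _) (c32 _ _) (c32 _ _) (c32 _ _)
        (c21 _ _).symm (c21 _ _).symm (c21 _ _).symm (c21 _ _).symm
        (c31 _ _).symm (c31 _ _).symm (c31 _ _).symm (c31 _ _).symm
        (by rw [g₂, r₂, map_neg]) (by rw [g₂, w₂, map_neg])
        (by rw [g₃, r₃, map_neg]) (by rw [g₃, w₃, map_neg]) (by rw [g₁, r₁]) (by rw [g₁, w₁])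
    · exact absurd (parity_arith k12 k123 s₁ s₂ s₃ s12 (v₁ r₁ w₁) (u₂ r₂ w₂) (u₃ r₃ w₃)) (by norm_num)
    · exact seven_sso horth.1 P₁ P₃ P₂ (c31 _ _) (c31 _ _) (c31 _ _) (c31 _ _)
        (c21 _ _) (c21 _ _) (c21 _ _) (c21 _ _)
        (c32 _ _).symm (c32 _ _).symm (c32 _ _).symm (c32 _ _).symm
        (by rw [g₁, r₁, map_neg]) (by rw [g₁, w₁, map_neg])
        (by rw [g₃, r₃, map_neg]) (by rw [g₃, w₃, map_neg]) (by rw [g₂, r₂]) (by rw [g₂, w₂])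
    · exact seven_sso horth.1 P₁ P₂ P₃ (c21 _ _) (c21 _ _) (c21 _ _) (c21 _ _)
        (c31 _ _) (c31 _ _) (c31 _ _) (c31 _ _) (c32 _ _) (c32 _ _) (c32 _ _) (c32 _ _)
        (by rw [g₁, r₁, map_neg]) (by rw [g₁, w₁, map_neg])
        (by rw [g₂, r₂, map_neg]) (by rw [g₂, w₂, map_neg]) (by rw [g₃, r₃]) (by rw [g₃, w₃])
    · exact absurd (parity_arith k12 k123 s₁ s₂ s₃ s12 (v₁ r₁ w₁) (v₂ r₂ w₂) (v₃ r₃ w₃)) (by norm_num)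
  obtain ⟨f, q, hs⟩ := hs
  exact main_abstract hF horth.1 h64 h36 hs hindex
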